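/- Let s≥2 and let ω∈H^s(𝕋[0,2π]) be the curve determined by θ̃∈Ḣ^s with ‖θ̃‖₁ sufficiently small so that |q₁[ω](α,α')|≥1/8 for 0<|α−α'|≤π. Then 𝒦[ω] maps H⁰(𝕋[0,2π]) into H^{s-2}(𝕋[0,2π]) with ‖𝒦[ω]f‖_{s-2} ≤ C₁‖f‖₀ exp(C₂‖ω_α‖_{s-1}), and 𝒦[ω] maps H¹(𝕋[0,2π]) into H^{s-1}(𝕋[0,2π]) with ‖𝒦[ω]f‖_{s-1} ≤ C₁‖f‖₁ exp(C₂‖ω_α‖_{s-1}), where C₁,C₂ are positive constants depending only on s. -/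

import Mathlib

open MeasureTheory Complex Filter
open scoped Real BigOperators

noncomputable section

namespace HeleShaw

/-- k-th Fourier coefficient of a 2π-periodic function `f : ℝ → ℂ`. -/
def fc (f : ℝ → ℂ) (k : ℤ) : ℂ :=
  (1 / (2 * (π : ℂ))) * ∫ α in (0:ℝ)..(2*π), f α * Complex.exp (-Complex.I * (k:ℂ) * (α:ℂ))

/-- Square of the Sobolev `H^s` norm, via Fourier coefficients. -/
def hnormSq (s : ℝ) (f : ℝ → ℂ) : ℝ :=
  (∑' k : ℤ, |(k:ℝ)| ^ (2*s) * ‖fc f k‖^2) + ‖fc f 0‖^2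

/-- The Sobolev `H^s` norm. -/
def hnorm (s : ℝ) (f : ℝ → ℂ) : ℝ := Real.sqrt (hnormSq s f)

/-- Membership in `H^s(𝕋[0,2π])`. -/
def MemH (s : ℝ) (f : ℝ → ℂ) : Prop :=
  Function.Periodic f (2*π) ∧ IntervalIntegrable f volume 0 (2*π) ∧
    Summable (fun k : ℤ => |(k:ℝ)| ^ (2*s) * ‖fc f k‖^2)

/-- Real-valued function. -/
def IsRealFn (f : ℝ → ℂ) : Prop := ∀ α, (f α).im = 0

/-- The projection 𝒬₁ removing Fourier modes `0, ±1`. -/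
def Q1 (f : ℝ → ℂ) (α : ℝ) : ℂ :=
  f α - fc f 0 - fc f 1 * Complex.exp (Complex.I * (α:ℂ))
    - fc f (-1) * Complex.exp (-Complex.I * (α:ℂ))

/-- Membership in `Ḣ^s`: real valued `H^s` functions fixed by 𝒬₁. -/
def MemHdot (s : ℝ) (f : ℝ → ℂ) : Prop :=
  MemH s f ∧ IsRealFn f ∧ fc f 0 = 0 ∧ fc f 1 = 0 ∧ fc f (-1) = 0

/-- The Hilbert transform, via Fourier multipliers `-i sgn k`. -/
def HT (f : ℝ → ℂ) (α : ℝ) : ℂ :=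
  ∑' k : ℤ, (-Complex.I) * (Int.sign k : ℂ) * fc f k * Complex.exp (Complex.I * (k:ℂ) * (α:ℂ))

/-- The commutator `[ℋ, ψ] f = ℋ(ψ f) - ψ ℋ(f)`. -/
def commHT (ψ f : ℝ → ℂ) (α : ℝ) : ℂ :=
  HT (fun β => ψ β * f β) α - ψ α * HT f α

/-- Real cotangent. -/
def rcot (x : ℝ) : ℝ := Real.cos x / Real.sin x

/-- The integral operator 𝒦[z]. -/
def Kop (z f : ℝ → ℂ) (α : ℝ) : ℂ :=
  (1 / (2 * (π:ℂ) * Complex.I)) *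
    ∫ β in (α - π)..(α + π),
      f β * (1 / (z α - z β) - 1 / (2 * deriv z β) * (rcot ((α - β)/2) : ℂ))

/-- The operator 𝒢[z]f = z_α [ℋ, 1/z_α] f + 2 i z_α 𝒦[z] f. -/
def Gop (z f : ℝ → ℂ) (α : ℝ) : ℂ :=
  deriv z α * commHT (fun β => 1 / deriv z β) f α + 2 * Complex.I * deriv z α * Kop z f α

/-- The operator ℱ[z]f = Re((1/i) 𝒢[z] f). -/
def Fop (z f : ℝ → ℂ) (α : ℝ) : ℝ := (Gop z f α / Complex.I).re

/-- The curve ω determined by θ̃ and `c = θ̂(1)` (with `θ̂(-1) = conj c`). -/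
def omegaCurve (θt : ℝ → ℂ) (c : ℂ) (α : ℝ) : ℂ :=
  ∫ τ in (0:ℝ)..α,
    Complex.exp (Complex.I * (τ:ℂ) + Complex.I * c * Complex.exp (Complex.I * (τ:ℂ))
      + Complex.I * (starRingEnd ℂ c) * Complex.exp (-Complex.I * (τ:ℂ)) + Complex.I * θt τ)

/-- θ = θ̃ + θ̂(1) e^{iα} + θ̂(-1) e^{-iα}. -/
def thetaFull (θt : ℝ → ℂ) (c : ℂ) (α : ℝ) : ℂ :=
  θt α + c * Complex.exp (Complex.I * (α:ℂ))
    + (starRingEnd ℂ c) * Complex.exp (-Complex.I * (α:ℂ))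

/-- The constraint (B.4). -/
def ConstraintB4 (θt : ℝ → ℂ) (c : ℂ) : Prop :=
  (∫ α in (0:ℝ)..(2*π),
    Complex.exp (Complex.I * (α:ℂ)
      + Complex.I * ((starRingEnd ℂ c) * Complex.exp (-Complex.I * (α:ℂ))
          + c * Complex.exp (Complex.I * (α:ℂ)) + θt α))) = 0

/-- The vortex sheet strength equation `(I + A_μ ℱ[ω]) γ = (2πσ/L) θ_αα`. -/
def GammaRel (σ L Aμ : ℝ) (θt : ℝ → ℂ) (c : ℂ) (γ : ℝ → ℂ) : Prop :=
  ∀ α, γ α + (Aμ:ℂ) * ((Fop (omegaCurve θt c) γ α : ℝ) : ℂ)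
      = ((2*π*σ/L : ℝ) : ℂ) * deriv (deriv (thetaFull θt c)) α

/-- The normal velocity `U = (π/L) ℋγ + (π/L) Re(𝒢[ω]γ)`. -/
def Ufn (L : ℝ) (ω γ : ℝ → ℂ) (α : ℝ) : ℂ :=
  ((π/L : ℝ) : ℂ) * HT γ α + ((π/L : ℝ) : ℂ) * ((Gop ω γ α).re : ℂ)

/-- The tangential velocity `T`. -/
def Tfn (θ U : ℝ → ℂ) (α : ℝ) : ℂ :=
  (∫ β in (0:ℝ)..α, (1 + deriv θ β) * U β)
    - ((α/(2*π) : ℝ) : ℂ) * ∫ β in (0:ℝ)..(2*π), (1 + deriv θ β) * U β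

/-- Galerkin projection `P_n`, keeping modes `2 ≤ |k| ≤ n`. -/
def Pn (n : ℕ) (f : ℝ → ℂ) (α : ℝ) : ℂ :=
  ∑ k ∈ Finset.Icc (-(n:ℤ)) (n:ℤ),
    if 2 ≤ |k| then fc f k * Complex.exp (Complex.I * (k:ℂ) * (α:ℂ)) else 0

/-- `z_α = (L/(2π)) e^{i(α+θ)}`. -/
def zDeriv (L : ℝ) (θ : ℝ → ℂ) (α : ℝ) : ℂ :=
  ((L/(2*π) : ℝ) : ℂ) * Complex.exp (Complex.I * ((α:ℂ) + θ α))

/-- The curve `z` with `z(0)=0` and `z_α = (L/(2π)) e^{i(α+θ)}`. -/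
def zCurve (L : ℝ) (θ : ℝ → ℂ) (α : ℝ) : ℂ := ∫ τ in (0:ℝ)..α, zDeriv L θ τ

/-- Area enclosed by the curve: `S = (1/2) Im ∫₀^{2π} z_α z* dα`. -/
def areaF (L : ℝ) (θ : ℝ → ℂ) : ℝ :=
  (1/2) * (∫ α in (0:ℝ)..(2*π), zDeriv L θ α * (starRingEnd ℂ) (zCurve L θ α)).im

/-- Divided difference `q₁[ω](α,α') = ∫₀¹ ω_α(tα+(1-t)α') dt`. -/
def q1 (ω : ℝ → ℂ) (α β : ℝ) : ℂ := ∫ t in (0:ℝ)..1, deriv ω (t*α + (1-t)*β)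

/-- Divided difference `q₂[ω](α,α') = ∫₀¹ (t-1) ω_αα((1-t)α + tα') dt`. -/
def q2 (ω : ℝ → ℂ) (α β : ℝ) : ℂ :=
  ∫ t in (0:ℝ)..1, ((t:ℂ) - 1) * deriv (deriv ω) ((1-t)*α + t*β)

/-- System (A.1)-(A.2) at time `t`. -/
def SystemA (σ Aμ : ℝ) (θ : ℝ → ℝ → ℂ) (L : ℝ → ℝ) (γ : ℝ → ℝ → ℂ) (t : ℝ) : Prop :=
  (∀ α, γ t α + (Aμ:ℂ) * ((Fop (zCurve (L t) (θ t)) (γ t) α : ℝ) : ℂ)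
      = ((2*π*σ/(L t) : ℝ) : ℂ) * deriv (deriv (θ t)) α) ∧
  (∀ α, deriv (fun τ => θ τ α) t
      = ((2*π/(L t) : ℝ) : ℂ) * (deriv (Ufn (L t) (zCurve (L t) (θ t)) (γ t)) α
        + Tfn (θ t) (Ufn (L t) (zCurve (L t) (θ t)) (γ t)) α * (1 + deriv (θ t) α))) ∧
  deriv L t = -(∫ α in (0:ℝ)..(2*π),
      ((1 + deriv (θ t) α) * Ufn (L t) (zCurve (L t) (θ t)) (γ t) α)).re

/-- The Galerkin system (C.1)-(C.2) at time `t`. -/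
def GalerkinSystem (n : ℕ) (σ Aμ : ℝ) (θt : ℝ → ℝ → ℂ) (Ln : ℝ → ℝ)
    (c : ℝ → ℂ) (γ : ℝ → ℝ → ℂ) (t : ℝ) : Prop :=
  ConstraintB4 (θt t) (c t) ∧
  fc (γ t) 0 = 0 ∧
  GammaRel σ (Ln t) Aμ (θt t) (c t) (γ t) ∧
  (∀ α, deriv (fun τ => θt τ α) t
     = ((2*π/(Ln t) : ℝ) : ℂ) * Pn n (fun β =>
         deriv (Ufn (Ln t) (omegaCurve (θt t) (c t)) (γ t)) β
         + Tfn (thetaFull (θt t) (c t)) (Ufn (Ln t) (omegaCurve (θt t) (c t)) (γ t)) β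
           * (1 + deriv (thetaFull (θt t) (c t)) β)) α) ∧
  deriv Ln t = -(∫ α in (0:ℝ)..(2*π),
     ((1 + deriv (thetaFull (θt t) (c t)) α)
       * Ufn (Ln t) (omegaCurve (θt t) (c t)) (γ t) α)).re

/-- System (B.1),(B.3),(B.4) at time `t`. -/
def SystemB (σ Aμ : ℝ) (θt : ℝ → ℝ → ℂ) (L : ℝ → ℝ)
    (c : ℝ → ℂ) (γ : ℝ → ℝ → ℂ) (t : ℝ) : Prop :=
  ConstraintB4 (θt t) (c t) ∧
  fc (γ t) 0 = 0 ∧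
  GammaRel σ (L t) Aμ (θt t) (c t) (γ t) ∧
  (∀ α, deriv (fun τ => θt τ α) t
     = ((2*π/(L t) : ℝ) : ℂ) * Q1 (fun β =>
         deriv (Ufn (L t) (omegaCurve (θt t) (c t)) (γ t)) β
         + Tfn (thetaFull (θt t) (c t)) (Ufn (L t) (omegaCurve (θt t) (c t)) (γ t)) β
           * (1 + deriv (thetaFull (θt t) (c t)) β)) α) ∧
  deriv L t = -(∫ α in (0:ℝ)..(2*π),
     ((1 + deriv (thetaFull (θt t) (c t)) α)
       * Ufn (L t) (omegaCurve (θt t) (c t)) (γ t) α)).re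

/-- Membership in the ball 𝓑 of radius ε in `Ḣ^r`. -/
def InBall (r ε : ℝ) (u : ℝ → ℂ) : Prop := MemHdot r u ∧ hnorm r u < ε

/-- Membership in 𝓥. -/
def InV (r ε : ℝ) (u : ℝ → ℂ) (v : ℝ) : Prop := InBall r ε u ∧ |v - 2*π| < 1


open scoped ENNReal NNReal

theorem lintegral_mul_sq_le {α : Type*} [MeasurableSpace α] {μ : Measure α} {x y : α → ℝ≥0∞}
    (hx : AEMeasurable x μ) (hy : AEMeasurable y μ) :
    (∫⁻ i, x i * y i ∂μ) ^ 2 ≤ (∫⁻ i, x i ∂μ) * ∫⁻ i, x i * y i ^ 2 ∂μ := by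
  have h := ENNReal.lintegral_mul_le_Lp_mul_Lq μ (p := 2) (q := 2) ⟨by norm_num, by norm_num, by norm_num⟩
    (f := fun i => x i ^ (1 / 2 : ℝ)) (g := fun i => x i ^ (1 / 2 : ℝ) * y i)
    (hx.pow_const _) ((hx.pow_const _).mul hy)
  have e0 : ∀ i, x i ^ (1 / 2 : ℝ) * x i ^ (1 / 2 : ℝ) = x i := fun i => by
    rw [← ENNReal.rpow_add_of_nonneg _ _ (by norm_num) (by norm_num)]; norm_num
  have e1 : ∀ i, (x i ^ (1 / 2 : ℝ)) ^ (2 : ℝ) = x i := fun i => by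
    rw [← ENNReal.rpow_mul]; norm_num
  simp only [Pi.mul_apply, ← mul_assoc, e0, ENNReal.mul_rpow_of_nonneg _ _ (show (0:ℝ) ≤ 2 by norm_num), e1] at h
  calc _ ≤ _ := pow_le_pow_left' h 2
    _ = _ := by
      rw [mul_pow]
      congr 1
      · rw [← ENNReal.rpow_natCast, ← ENNReal.rpow_mul]; norm_num
      · rw [← ENNReal.rpow_natCast, ← ENNReal.rpow_mul]; norm_num

theorem tsum_mul_sq_le (x y : ℤ → ℝ≥0∞) :
    (∑' i, x i * y i) ^ 2 ≤ (∑' i, x i) * ∑' i, x i * y i ^ 2 := by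
  simp only [← MeasureTheory.lintegral_count]
  exact lintegral_mul_sq_le (measurable_of_countable _).aemeasurable
    (measurable_of_countable _).aemeasurable

/-- Young's inequality `ℓ¹ * ℓ² ⊆ ℓ²`. -/
theorem young_conv (x y : ℤ → ℝ≥0∞) :
    ∑' n, (∑' m, x (n - m) * y m) ^ 2 ≤ (∑' n, x n) ^ 2 * ∑' n, y n ^ 2 := by
  calc ∑' n, (∑' m, x (n - m) * y m) ^ 2
      ≤ ∑' n, (∑' m, x m) * ∑' m, x (n - m) * y m ^ 2 := by
        refine ENNReal.tsum_le_tsum fun n => (tsum_mul_sq_le _ _).trans_eq ?_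
        rw [← (Equiv.subLeft n).tsum_eq x]; rfl
    _ = (∑' m, x m) * ∑' m, (∑' n, x (n - m)) * y m ^ 2 := by
        rw [ENNReal.tsum_mul_left, ENNReal.tsum_comm]
        simp only [ENNReal.tsum_mul_right]
    _ = _ := by
        have : ∀ m, ∑' n, x (n - m) = ∑' n, x n := fun m => (Equiv.subRight m).tsum_eq x
        simp only [this, ENNReal.tsum_mul_left]
        ring

/-- The weight `1 + |n|`. -/
def wt (n : ℤ) : ℝ≥0∞ := 1 + (n.natAbs : ℝ≥0∞)

/-- The weighted `ℓ²` energy of a sequence. -/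
def energy (ρ : ℝ) (x : ℤ → ℝ≥0∞) : ℝ≥0∞ := ∑' n, wt n ^ (2 * ρ) * x n ^ 2

theorem one_le_wt (n : ℤ) : 1 ≤ wt n := le_self_add
theorem wt_ne_zero (n : ℤ) : wt n ≠ 0 := (zero_lt_one.trans_le (one_le_wt n)).ne'
theorem wt_ne_top (n : ℤ) : wt n ≠ ⊤ := by simp [wt]
theorem wt_mono {m n : ℤ} (h : m.natAbs ≤ n.natAbs) : wt m ≤ wt n := by
  unfold wt; gcongr
theorem wt_le_add (n m : ℤ) : wt n ≤ wt (n - m) + wt m := by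
  unfold wt
  have : ((n.natAbs : ℕ) : ℝ≥0∞) ≤ ((n - m).natAbs : ℕ) + (m.natAbs : ℕ) := by
    exact_mod_cast (by omega : n.natAbs ≤ (n-m).natAbs + m.natAbs)
  calc (1 : ℝ≥0∞) + n.natAbs ≤ 1 + (((n - m).natAbs : ℕ) + (m.natAbs : ℕ)) := by gcongr
    _ ≤ 1 + (((n - m).natAbs : ℕ) + (m.natAbs : ℕ)) + 1 := le_self_add
    _ = _ := by ring
theorem wt_rpow_add (n : ℤ) (a b : ℝ) : wt n ^ (a + b) = wt n ^ a * wt n ^ b :=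
  ENNReal.rpow_add _ _ (wt_ne_zero n) (wt_ne_top n)
theorem wt_rpow_mono (n : ℤ) {a b : ℝ} (h : a ≤ b) : wt n ^ a ≤ wt n ^ b :=
  ENNReal.rpow_le_rpow_of_exponent_le (one_le_wt n) h

theorem wt_rpow_sq (n : ℤ) (a : ℝ) (x : ℝ≥0∞) : (wt n ^ a * x) ^ 2 = wt n ^ (2 * a) * x ^ 2 := by
  rw [mul_pow, ← ENNReal.rpow_natCast, ← ENNReal.rpow_mul]; norm_num [mul_comm]

theorem energy_mono {ρ : ℝ} {x y : ℤ → ℝ≥0∞} (h : ∀ n, x n ≤ y n) : energy ρ x ≤ energy ρ y :=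
  ENNReal.tsum_le_tsum fun n => by gcongr; exact h n

theorem energy_mono_exp {ρ σ : ℝ} (h : ρ ≤ σ) (x : ℤ → ℝ≥0∞) : energy ρ x ≤ energy σ x :=
  ENNReal.tsum_le_tsum fun n => by
    gcongr ?_ * _
    exact wt_rpow_mono n (by linarith)

theorem energy_add (ρ : ℝ) (x y : ℤ → ℝ≥0∞) :
    energy ρ (fun n => x n + y n) ≤ 2 * (energy ρ x + energy ρ y) := by
  unfold energy
  rw [← ENNReal.tsum_add, ← ENNReal.tsum_mul_left]
  refine ENNReal.tsum_le_tsum fun n => ?_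
  have h : (x n + y n) ^ 2 ≤ 2 * (x n ^ 2 + y n ^ 2) := by
    have := ENNReal.rpow_add_le_mul_rpow_add_rpow (x n) (y n) (p := 2) (by norm_num)
    norm_num at this
    exact_mod_cast this
  calc _ ≤ wt n ^ (2 * ρ) * (2 * (x n ^ 2 + y n ^ 2)) := by gcongr
    _ = _ := by ring

theorem energy_const_mul (ρ : ℝ) (c : ℝ≥0∞) (x : ℤ → ℝ≥0∞) :
    energy ρ (fun n => c * x n) = c ^ 2 * energy ρ x := by
  unfold energy
  rw [← ENNReal.tsum_mul_left]
  exact tsum_congr fun n => by ring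

theorem energy_wt (ρ σ : ℝ) (x : ℤ → ℝ≥0∞) :
    energy ρ (fun n => wt n ^ σ * x n) = energy (ρ + σ) x := by
  unfold energy
  refine tsum_congr fun n => ?_
  rw [wt_rpow_sq, ← mul_assoc, ← wt_rpow_add]; ring_nf

theorem energy_zero_eq (x : ℤ → ℝ≥0∞) : energy 0 x = ∑' n, x n ^ 2 := by simp [energy]

theorem tsum_wt_neg_ne_top {a : ℝ} (ha : 1 < a) : ∑' n : ℤ, wt n ^ (-a) ≠ ⊤ := by
  have h1 : Summable fun n : ℕ => ((1 + (n:ℝ)) ^ a)⁻¹ := by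
    have := (Real.summable_nat_rpow_inv.2 ha).comp_injective (add_right_injective 1)
    refine this.congr fun n => by simp
  have h2 : Summable fun n : ℤ => ((1 + (n.natAbs:ℝ)) ^ a)⁻¹ := by
    refine Summable.of_nat_of_neg ?_ ?_ <;> simpa using h1
  have h3 := h2.tsum_ofReal_ne_top
  convert h3 using 3 with n
  rw [← Real.rpow_neg (by positivity), ← ENNReal.ofReal_rpow_of_pos (by positivity), wt,
    ENNReal.ofReal_add (by simp) (by positivity), ENNReal.ofReal_one, ENNReal.ofReal_natCast]

theorem tsum_sq_le_energy (ρ : ℝ) (x : ℤ → ℝ≥0∞) :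
    (∑' n, x n) ^ 2 ≤ (∑' n, wt n ^ (-(2 * ρ))) * energy ρ x := by
  have h := tsum_mul_sq_le (fun n => wt n ^ (-(2*ρ))) (fun n => wt n ^ (2*ρ) * x n)
  have e : ∀ n (z : ℝ≥0∞), wt n ^ (-(2*ρ)) * (wt n ^ (2*ρ) * z) = z := fun n z => by
    rw [← mul_assoc, ← wt_rpow_add]; simp
  simp only [e] at h
  refine h.trans_eq ?_
  congr 1
  refine tsum_congr fun n => ?_
  rw [pow_two (wt n ^ (2*ρ) * x n), ← mul_assoc, e]
  ring

theorem tsum_sq_le_energy_of_one_le : ∃ C : ℝ≥0, ∀ ρ : ℝ, 1 ≤ ρ → ∀ x : ℤ → ℝ≥0∞,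
    (∑' n, x n) ^ 2 ≤ C * energy ρ x := by
  refine ⟨(∑' n, wt n ^ (-(2:ℝ))).toNNReal, fun ρ hρ x => ?_⟩
  rw [ENNReal.coe_toNNReal (tsum_wt_neg_ne_top (by norm_num))]
  refine (tsum_sq_le_energy 1 x).trans ?_
  rw [mul_one]
  gcongr
  exact energy_mono_exp hρ x

theorem wt_peetre {σ ρ : ℝ} (hσ : 0 ≤ σ) (h : σ ≤ ρ) (n m : ℤ) :
    wt n ^ σ ≤ 2 ^ σ * (wt m ^ σ + wt (n - m) ^ ρ * wt m ^ (σ - ρ)) := by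
  rcases le_total (wt (n - m)) (wt m) with hm | hm
  · calc wt n ^ σ ≤ (2 * wt m) ^ σ := by
          gcongr
          exact (wt_le_add n m).trans (by rw [two_mul]; gcongr)
      _ = 2 ^ σ * wt m ^ σ := ENNReal.mul_rpow_of_nonneg _ _ hσ
      _ ≤ _ := by gcongr; exact le_self_add
  · calc wt n ^ σ ≤ (2 * wt (n - m)) ^ σ := by
          gcongr
          exact (wt_le_add n m).trans (by rw [two_mul]; gcongr)
      _ = 2 ^ σ * (wt (n - m) ^ ρ * wt (n - m) ^ (σ - ρ)) := by
          rw [ENNReal.mul_rpow_of_nonneg _ _ hσ, ← wt_rpow_add]; ring_nf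
      _ ≤ 2 ^ σ * (wt (n - m) ^ ρ * wt m ^ (σ - ρ)) := by
          gcongr 2 ^ σ * (_ * ?_)
          rw [← neg_sub ρ σ, ENNReal.rpow_neg, ENNReal.rpow_neg]
          exact ENNReal.inv_le_inv.2 (ENNReal.rpow_le_rpow hm (by linarith))
      _ ≤ _ := by gcongr; exact le_add_self

/-- Product estimate `H^ρ · H^σ ⊆ H^σ` for `0 ≤ σ ≤ ρ` and `1 ≤ ρ`, on Fourier coefficients. -/
theorem energy_conv (R : ℝ) : ∃ C : ℝ≥0, ∀ σ ρ : ℝ, 0 ≤ σ → σ ≤ ρ → 1 ≤ ρ → ρ ≤ R →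
    ∀ x y z : ℤ → ℝ≥0∞, (∀ n, z n ≤ ∑' m, x (n - m) * y m) →
      energy σ z ≤ C * (energy ρ x * energy σ y) := by
  obtain ⟨K, hK⟩ := tsum_sq_le_energy_of_one_le
  refine ⟨(2 ^ R) ^ 2 * (2 * (K + K)), fun σ ρ hσ h h1 hR x y z hz => ?_⟩
  have hstep : ∀ n, wt n ^ σ * z n ≤ 2 ^ R * (∑' m, x (n - m) * (wt m ^ σ * y m) +
      ∑' m, (wt (n - m) ^ ρ * x (n - m)) * (wt m ^ (σ - ρ) * y m)) := fun n => by
    calc wt n ^ σ * z n ≤ wt n ^ σ * ∑' m, x (n - m) * y m := by gcongr; exact hz n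
      _ = ∑' m, wt n ^ σ * (x (n - m) * y m) := ENNReal.tsum_mul_left.symm
      _ ≤ ∑' m, 2 ^ R * (wt m ^ σ + wt (n - m) ^ ρ * wt m ^ (σ - ρ)) * (x (n - m) * y m) := by
          refine ENNReal.tsum_le_tsum fun m => ?_
          gcongr
          refine (wt_peetre hσ h n m).trans ?_
          gcongr
          · norm_num
          · linarith
      _ = _ := by
          rw [← ENNReal.tsum_add, ← ENNReal.tsum_mul_left]
          exact tsum_congr fun m => by ring
  have e1 : energy σ z = energy 0 (fun n => wt n ^ σ * z n) := by rw [energy_wt, zero_add]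
  rw [e1]
  refine (energy_mono hstep).trans ?_
  rw [energy_const_mul]
  have hA : energy 0 (fun n => ∑' m, x (n - m) * (wt m ^ σ * y m)) ≤ K * (energy ρ x * energy σ y) := by
    rw [energy_zero_eq]
    refine (young_conv _ _).trans ?_
    rw [← energy_zero_eq (fun m => wt m ^ σ * y m), energy_wt, zero_add, ← mul_assoc]
    gcongr
    exact hK ρ h1 x
  have hB : energy 0 (fun n => ∑' m, (wt (n - m) ^ ρ * x (n - m)) * (wt m ^ (σ - ρ) * y m))
      ≤ K * (energy ρ x * energy σ y) := by
    rw [energy_zero_eq]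
    have : ∀ n, ∑' m, (wt (n - m) ^ ρ * x (n - m)) * (wt m ^ (σ - ρ) * y m) =
        ∑' m, (wt (n - m) ^ (σ - ρ) * y (n - m)) * (wt m ^ ρ * x m) := fun n => by
      rw [← (Equiv.subLeft n).tsum_eq]
      refine tsum_congr fun m => ?_
      simp [Equiv.subLeft_apply]; ring
    simp only [this]
    refine (young_conv (fun m => wt m ^ (σ - ρ) * y m) (fun m => wt m ^ ρ * x m)).trans ?_
    rw [← energy_zero_eq (fun m => wt m ^ ρ * x m), energy_wt, zero_add, mul_comm (energy ρ x),
      ← mul_assoc]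
    gcongr
    have := hK ρ h1 (fun m => wt m ^ (σ - ρ) * y m)
    rwa [energy_wt, add_sub_cancel] at this
  calc _ ≤ (2 ^ R) ^ 2 * (2 * (K * (energy ρ x * energy σ y) + K * (energy ρ x * energy σ y))) := by
        gcongr
        exact (energy_add 0 _ _).trans (by gcongr)
    _ = _ := by
        push_cast
        rw [ENNReal.coe_rpow_of_ne_zero (by norm_num)]
        push_cast
        ring

theorem tsum_natAbs_le (g : ℕ → ℝ≥0∞) : ∑' n : ℤ, g n.natAbs ≤ 2 * ∑' n, g n := by
  rw [tsum_of_nat_of_neg_add_one ENNReal.summable ENNReal.summable, two_mul]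
  refine add_le_add (by simp) ?_
  · have : ∀ n : ℕ, (-((n:ℤ) + 1)).natAbs = n + 1 := fun n => by omega
    simp only [this]
    exact ENNReal.tsum_comp_le_tsum_of_injective (add_left_injective 1) g

theorem wt_rpow_eq_ofReal (n : ℤ) (a : ℝ) :
    wt n ^ a = ENNReal.ofReal ((1 + (n.natAbs : ℝ)) ^ a) := by
  rw [← ENNReal.ofReal_rpow_of_pos (by positivity), wt,
    ENNReal.ofReal_add (by simp) (by positivity), ENNReal.ofReal_one, ENNReal.ofReal_natCast]

theorem rpow_neg_three_half_le (k : ℕ) : (1 + (k:ℝ)) ^ (-(3/2) : ℝ) ≤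
    6 * ((1 + (k:ℝ)) ^ (-(1/2) : ℝ) - (1 + ((k + 1 : ℕ) : ℝ)) ^ (-(1/2) : ℝ)) := by
  have hk : (0:ℝ) ≤ k := k.cast_nonneg
  rw [Real.rpow_neg (by positivity), Real.rpow_neg (by positivity), Real.rpow_neg (by positivity),
    ← Real.sqrt_eq_rpow, ← Real.sqrt_eq_rpow,
    show (3/2:ℝ) = 1 + 1/2 by norm_num, Real.rpow_add (by positivity), Real.rpow_one,
    ← Real.sqrt_eq_rpow]
  set a := √(1 + (k:ℝ)) with ha
  set b := √(1 + ((k+1:ℕ):ℝ)) with hb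
  have ha2 : a ^ 2 = 1 + k := Real.sq_sqrt (by positivity)
  have hb2 : b ^ 2 = 2 + k := by
    have : b ^ 2 = 1 + ((k+1:ℕ):ℝ) := Real.sq_sqrt (by positivity)
    rw [this]; push_cast; ring
  have ha0 : 0 < a := Real.sqrt_pos.2 (by positivity)
  have hb0 : 0 < b := Real.sqrt_pos.2 (by positivity)
  have hab : b ≤ 2 * a := by nlinarith
  rw [← ha2, ← sub_nonneg]
  have : 6 * (a⁻¹ - b⁻¹) - (a ^ 2 * a)⁻¹ = (6 * a ^ 2 * (b - a) - b) / (a ^ 3 * b) := by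
    field_simp
  rw [this]
  apply div_nonneg _ (by positivity)
  have h1 : (b - a) * (a + b) = 1 := by nlinarith
  have h2 : b * (a + b) ≤ 6 * a ^ 2 := by nlinarith
  have h3 : 0 < b - a := by
    by_contra h
    nlinarith
  nlinarith [mul_le_mul_of_nonneg_left h2 h3.le]

theorem tsum_tail_wt_le : ∀ n : ℤ,
    (∑' k : ℤ, if n.natAbs ≤ k.natAbs then wt k ^ (-(3/2) : ℝ) else 0) ≤
      12 * wt n ^ (-(1/2) : ℝ) := by
  intro n
  set N := n.natAbs
  have h := tsum_natAbs_le
    (fun k => if N ≤ k then ENNReal.ofReal ((1 + (k:ℝ)) ^ (-(3/2) : ℝ)) else 0)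
  have e : ∀ k : ℤ, (if N ≤ k.natAbs then wt k ^ (-(3/2) : ℝ) else 0) =
      (fun k : ℕ => if N ≤ k then ENNReal.ofReal ((1 + (k:ℝ)) ^ (-(3/2) : ℝ)) else 0) k.natAbs :=
    fun k => by simp only [wt_rpow_eq_ofReal]
  simp only [e]
  refine h.trans ?_
  have hs : ∑' k, (if N ≤ k then ENNReal.ofReal ((1 + (k:ℝ)) ^ (-(3/2) : ℝ)) else 0) ≤
      ENNReal.ofReal (6 * (1 + (N:ℝ)) ^ (-(1/2) : ℝ)) := by
    refine ENNReal.tsum_le_of_sum_range_le fun m => ?_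
    have e2 : ∀ k : ℕ, (if N ≤ k then ENNReal.ofReal ((1 + (k:ℝ)) ^ (-(3/2) : ℝ)) else 0) =
        ENNReal.ofReal (if N ≤ k then (1 + (k:ℝ)) ^ (-(3/2) : ℝ) else 0) := fun k => by
      split_ifs <;> simp
    simp only [e2]
    rw [← ENNReal.ofReal_sum_of_nonneg (fun k _ => by positivity)]
    apply ENNReal.ofReal_le_ofReal
    have key : ∑ k ∈ Finset.range m, (if N ≤ k then (1 + (k:ℝ)) ^ (-(3/2) : ℝ) else 0) ≤
        if m ≤ N then 0 else
          6 * ((1 + (N:ℝ)) ^ (-(1/2) : ℝ) - (1 + (m:ℝ)) ^ (-(1/2) : ℝ)) := by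
      induction m with
      | zero => simp
      | succ m ih =>
        rw [Finset.sum_range_succ]
        have hm := rpow_neg_three_half_le m
        rcases lt_trichotomy m N with h | h | h
        · rw [if_neg (by omega), if_pos (by omega)]
          rw [if_pos (by omega)] at ih
          linarith
        · subst h
          rw [if_pos le_rfl, if_neg (by omega)]
          rw [if_pos le_rfl] at ih
          linarith
        · rw [if_pos (by omega), if_neg (by omega)]
          rw [if_neg (by omega)] at ih
          linarith
    refine key.trans ?_
    split_ifs
    · positivity
    · have : (0:ℝ) ≤ (1 + (m:ℝ)) ^ (-(1/2) : ℝ) := by positivity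
      linarith
  calc _ ≤ 2 * ENNReal.ofReal (6 * (1 + (N:ℝ)) ^ (-(1/2) : ℝ)) := by gcongr
    _ = _ := by
      rw [ENNReal.ofReal_mul (by norm_num), wt_rpow_eq_ofReal, ← mul_assoc]
      congr 1
      norm_num

theorem tsum_head_wt_le : ∀ n : ℤ,
    (∑' k : ℤ, if k.natAbs ≤ n.natAbs then wt k ^ (-(1/2) : ℝ) else 0) ≤
      4 * wt n ^ (1/2 : ℝ) := by
  intro n
  set N := n.natAbs
  have h := tsum_natAbs_le
    (fun k => if k ≤ N then ENNReal.ofReal ((1 + (k:ℝ)) ^ (-(1/2) : ℝ)) else 0)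
  have e : ∀ k : ℤ, (if k.natAbs ≤ N then wt k ^ (-(1/2) : ℝ) else 0) =
      (fun k : ℕ => if k ≤ N then ENNReal.ofReal ((1 + (k:ℝ)) ^ (-(1/2) : ℝ)) else 0) k.natAbs :=
    fun k => by simp only [wt_rpow_eq_ofReal]
  simp only [e]
  refine h.trans ?_
  have hs : ∑' k, (if k ≤ N then ENNReal.ofReal ((1 + (k:ℝ)) ^ (-(1/2) : ℝ)) else 0) ≤
      ENNReal.ofReal (2 * (1 + (N:ℝ)) ^ (1/2 : ℝ)) := by
    refine ENNReal.tsum_le_of_sum_range_le fun m => ?_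
    have e2 : ∀ k : ℕ, (if k ≤ N then ENNReal.ofReal ((1 + (k:ℝ)) ^ (-(1/2) : ℝ)) else 0) =
        ENNReal.ofReal (if k ≤ N then (1 + (k:ℝ)) ^ (-(1/2) : ℝ) else 0) := fun k => by
      split_ifs <;> simp
    simp only [e2]
    rw [← ENNReal.ofReal_sum_of_nonneg (fun k _ => by positivity)]
    apply ENNReal.ofReal_le_ofReal
    have key : ∑ k ∈ Finset.range m, (if k ≤ N then (1 + (k:ℝ)) ^ (-(1/2) : ℝ) else 0) ≤
        2 * √(min m (N + 1) : ℕ) := by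
      induction m with
      | zero => simp
      | succ m ih =>
        rw [Finset.sum_range_succ]
        rcases lt_or_ge N m with h | h
        · rw [if_neg (by omega), add_zero]
          rwa [min_eq_right (by omega)] at ih ⊢
        · rw [if_pos h]
          rw [min_eq_left (by omega)] at ih ⊢
          have : (1 + (m:ℝ)) ^ (-(1/2) : ℝ) ≤ 2 * (√((m+1:ℕ):ℝ) - √m) := by
            rw [Real.rpow_neg (by positivity), ← Real.sqrt_eq_rpow]
            have e : ((m+1:ℕ):ℝ) = 1 + m := by push_cast; ring
            rw [e]
            set a := √(m:ℝ)
            set b := √(1 + (m:ℝ))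
            have ha2 : a ^ 2 = m := Real.sq_sqrt (by positivity)
            have hb2 : b ^ 2 = 1 + m := Real.sq_sqrt (by positivity)
            have ha0 : 0 ≤ a := Real.sqrt_nonneg _
            have hb0 : 0 < b := Real.sqrt_pos.2 (by positivity)
            rw [inv_le_iff_one_le_mul₀ hb0]
            nlinarith [sq_nonneg (a - b)]
          linarith
    refine key.trans ?_
    rw [← Real.sqrt_eq_rpow]
    have : ((min m (N + 1) : ℕ) : ℝ) ≤ 1 + N := by
      have : min m (N+1) ≤ 1 + N := by omega
      exact_mod_cast this
    gcongr
  calc _ ≤ 2 * ENNReal.ofReal (2 * (1 + (N:ℝ)) ^ (1/2 : ℝ)) := by gcongr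
    _ = _ := by
      rw [ENNReal.ofReal_mul (by norm_num), wt_rpow_eq_ofReal, ← mul_assoc]
      congr 1
      norm_num

/-- A weighted discrete Hardy inequality. -/
theorem energy_hardy {ρ : ℝ} (hρ : 0 ≤ ρ) {x y : ℤ → ℝ≥0∞}
    (h : ∀ n, x n ≤ ∑' k : ℤ, if n.natAbs ≤ k.natAbs then y k else 0) :
    energy ρ x ≤ 48 * energy (ρ + 1) y := by
  have h1 : ∀ n, x n ^ 2 ≤ 12 * wt n ^ (-(1/2) : ℝ) *
      ∑' k : ℤ, (if n.natAbs ≤ k.natAbs then wt k ^ (3/2 : ℝ) * y k ^ 2 else 0) := fun n => by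
    have := tsum_mul_sq_le (fun k : ℤ => if n.natAbs ≤ k.natAbs then wt k ^ (-(3/2) : ℝ) else 0)
      (fun k => wt k ^ (3/2 : ℝ) * y k)
    calc x n ^ 2 ≤ (∑' k : ℤ, if n.natAbs ≤ k.natAbs then y k else 0) ^ 2 := by gcongr; exact h n
      _ ≤ _ := by
        refine (le_of_eq ?_).trans (this.trans ?_)
        · congr 1
          refine tsum_congr fun k => ?_
          split_ifs
          · rw [← mul_assoc, ← wt_rpow_add]; simp
          · simp
        · refine mul_le_mul' (tsum_tail_wt_le n) (ENNReal.tsum_le_tsum fun k => ?_)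
          split_ifs
          · rw [wt_rpow_sq, ← mul_assoc, ← wt_rpow_add]; norm_num
          · simp
  calc energy ρ x ≤ ∑' n, wt n ^ (2 * ρ) * (12 * wt n ^ (-(1/2) : ℝ) *
        ∑' k : ℤ, (if n.natAbs ≤ k.natAbs then wt k ^ (3/2 : ℝ) * y k ^ 2 else 0)) :=
        ENNReal.tsum_le_tsum fun n => by gcongr; exact h1 n
    _ = ∑' n, ∑' k : ℤ, wt n ^ (2 * ρ) * (12 * wt n ^ (-(1/2) : ℝ) *
        (if n.natAbs ≤ k.natAbs then wt k ^ (3/2 : ℝ) * y k ^ 2 else 0)) := by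
        simp only [ENNReal.tsum_mul_left]
    _ = ∑' k : ℤ, ∑' n, wt n ^ (2 * ρ) * (12 * wt n ^ (-(1/2) : ℝ) *
        (if n.natAbs ≤ k.natAbs then wt k ^ (3/2 : ℝ) * y k ^ 2 else 0)) := ENNReal.tsum_comm
    _ ≤ ∑' k : ℤ, ∑' n : ℤ, (wt k ^ (2 * ρ) * 12 * (wt k ^ (3/2 : ℝ) * y k ^ 2)) *
          (if n.natAbs ≤ k.natAbs then wt n ^ (-(1/2) : ℝ) else 0) := by
        refine ENNReal.tsum_le_tsum fun k => ENNReal.tsum_le_tsum fun n => ?_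
        split_ifs with hnk
        · have : wt n ^ (2 * ρ) ≤ wt k ^ (2 * ρ) :=
            ENNReal.rpow_le_rpow (wt_mono hnk) (by linarith)
          calc _ ≤ wt k ^ (2 * ρ) * (12 * wt n ^ (-(1/2) : ℝ) * (wt k ^ (3/2 : ℝ) * y k ^ 2)) := by
                gcongr
            _ = _ := by ring
        · simp
    _ ≤ ∑' k : ℤ, (wt k ^ (2 * ρ) * 12 * (wt k ^ (3/2 : ℝ) * y k ^ 2)) *
          (4 * wt k ^ (1/2 : ℝ)) := by
        refine ENNReal.tsum_le_tsum fun k => ?_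
        rw [ENNReal.tsum_mul_left]
        gcongr
        exact tsum_head_wt_le k
    _ = _ := by
        rw [energy, ← ENNReal.tsum_mul_left]
        refine tsum_congr fun k => ?_
        have : wt k ^ (2 * (ρ + 1)) = wt k ^ (2 * ρ) * (wt k ^ (3/2 : ℝ) * wt k ^ (1/2 : ℝ)) := by
          rw [← wt_rpow_add, ← wt_rpow_add]; ring_nf
        rw [this]; ring

/-- Lower semicontinuity of the energy under pointwise convergence. -/
theorem energy_le_of_tendsto {ρ : ℝ} {X : ℕ → ℤ → ℂ} {x : ℤ → ℂ} {B : ℝ≥0∞}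
    (h : ∀ n, Tendsto (fun N => X N n) atTop (nhds (x n)))
    (hB : ∀ᶠ N in atTop, energy ρ (fun n => ‖X N n‖ₑ) ≤ B) : energy ρ (fun n => ‖x n‖ₑ) ≤ B := by
  rw [energy, ENNReal.tsum_eq_iSup_sum]
  refine iSup_le fun S => ?_
  have ht : Tendsto (fun N => ∑ n ∈ S, wt n ^ (2 * ρ) * ‖X N n‖ₑ ^ 2) atTop
      (nhds (∑ n ∈ S, wt n ^ (2 * ρ) * ‖x n‖ₑ ^ 2)) := by
    refine tendsto_finsetSum _ fun n _ => ?_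
    refine ENNReal.Tendsto.const_mul ?_ (Or.inr ?_)
    · exact ((ENNReal.continuous_pow 2).tendsto _).comp ((continuous_enorm.tendsto _).comp (h n))
    · rw [wt_rpow_eq_ofReal]; exact ENNReal.ofReal_ne_top
  refine le_of_tendsto ht (hB.mono fun N hN => ?_)
  exact (ENNReal.sum_le_tsum S).trans hN

theorem energy_add_one_le (σ : ℝ) (x : ℤ → ℝ≥0∞) :
    energy (σ + 1) x ≤ 4 * (energy 0 x + energy σ (fun n => (n.natAbs : ℝ≥0∞) * x n)) := by
  have h : ∀ n, wt n ^ (2 * (σ + 1)) ≤ 2 ^ (2:ℝ) * (n.natAbs : ℝ≥0∞) ^ 2 * wt n ^ (2 * σ) + 4 := by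
    intro n
    rcases Nat.eq_zero_or_pos n.natAbs with h0 | h0
    · have : wt n = 1 := by simp [wt, h0]
      rw [this]; simp only [ENNReal.one_rpow]
      exact le_trans (by norm_num) le_add_self
    · have : wt n ≤ 2 * (n.natAbs : ℝ≥0∞) := by
        rw [wt, two_mul]; gcongr; exact_mod_cast h0
      refine le_trans ?_ le_self_add
      rw [show 2 * (σ + 1) = 2 + 2 * σ by ring, wt_rpow_add]
      gcongr
      calc wt n ^ (2:ℝ) ≤ (2 * (n.natAbs : ℝ≥0∞)) ^ (2:ℝ) := by gcongr
        _ = _ := by rw [ENNReal.mul_rpow_of_nonneg _ _ (by norm_num)]; norm_num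
  unfold energy
  rw [← ENNReal.tsum_add, ← ENNReal.tsum_mul_left]
  refine ENNReal.tsum_le_tsum fun n => ?_
  calc _ ≤ (2 ^ (2:ℝ) * (n.natAbs : ℝ≥0∞) ^ 2 * wt n ^ (2 * σ) + 4) * x n ^ 2 := by
        gcongr; exact h n
    _ = _ := by norm_num; ring

theorem energy_natAbs_le (σ : ℝ) (x : ℤ → ℝ≥0∞) :
    energy σ (fun n => (n.natAbs : ℝ≥0∞) * x n) ≤ energy (σ + 1) x := by
  rw [← energy_wt]
  refine energy_mono fun n => ?_
  rw [ENNReal.rpow_one]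
  gcongr
  exact le_add_self

/-- The exponential `α ↦ e^{ikα}`. -/
def ek (k : ℤ) (α : ℝ) : ℂ := Complex.exp (I * k * α)

theorem continuous_ek (k : ℤ) : Continuous (ek k) := by unfold ek; fun_prop
theorem ek_zero (α : ℝ) : ek 0 α = 1 := by simp [ek]
theorem ek_add (k l : ℤ) (α : ℝ) : ek (k + l) α = ek k α * ek l α := by
  rw [ek, ek, ek, ← Complex.exp_add]; push_cast; ring_nf
theorem norm_ek (k : ℤ) (α : ℝ) : ‖ek k α‖ = 1 := by
  rw [ek, show I * (k:ℂ) * (α:ℂ) = ((k * α : ℝ) : ℂ) * I by push_cast; ring]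
  exact Complex.norm_exp_ofReal_mul_I _
theorem enorm_ek (k : ℤ) (α : ℝ) : ‖ek k α‖ₑ = 1 := by
  rw [← ofReal_norm, norm_ek]; simp
theorem ek_periodic (k : ℤ) : Function.Periodic (ek k) (2 * π) := fun α => by
  rw [ek, ek, show I * (k:ℂ) * ((α + 2 * π : ℝ) : ℂ) = I * k * α + k * (2 * π * I) by
    push_cast; ring, Complex.exp_add, Complex.exp_int_mul_two_pi_mul_I, mul_one]
theorem ek_neg (k : ℤ) (α : ℝ) : ek (-k) α = (starRingEnd ℂ) (ek k α) := by
  rw [ek, ek, ← Complex.exp_conj]; simp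
theorem hasDerivAt_ek (k : ℤ) (α : ℝ) : HasDerivAt (ek k) (I * k * ek k α) α := by
  have h : HasDerivAt (fun x : ℝ => I * (k:ℂ) * (x:ℂ)) (I * k * 1) α :=
    (Complex.ofRealCLM.hasDerivAt (x := α)).const_mul _
  have h2 := h.cexp
  rw [mul_one, mul_comm (cexp _)] at h2
  exact h2

theorem fc_eq (f : ℝ → ℂ) (k : ℤ) :
    fc f k = (1 / (2 * (π : ℂ))) * ∫ α in (0:ℝ)..(2*π), ek (-k) α * f α := by
  unfold fc ek
  congr 2; ext α; push_cast; ring_nf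

theorem fc_eq_fourierCoeffOn (f : ℝ → ℂ) (k : ℤ) :
    fc f k = fourierCoeffOn Real.two_pi_pos f k := by
  rw [fourierCoeffOn_eq_integral, fc_eq, Complex.real_smul]
  congr 1
  · push_cast; ring
  · refine intervalIntegral.integral_congr fun x _ => ?_
    simp only [smul_eq_mul]
    rw [fourier_coe_apply, ek]
    have : (π:ℂ) ≠ 0 := by exact_mod_cast Real.pi_ne_zero
    congr 2
    push_cast; field_simp; ring

theorem fc_ek (k n : ℤ) : fc (ek k) n = if n = k then 1 else 0 := by
  have hp : (2 * (π:ℂ)) ≠ 0 := by exact_mod_cast Real.two_pi_pos.ne'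
  rw [fc_eq]
  simp only [← ek_add]
  split_ifs with h
  · subst h; simp only [neg_add_cancel, ek_zero, intervalIntegral.integral_const, sub_zero,
      Complex.real_smul, mul_one]; push_cast; exact one_div_mul_cancel hp
  · have hk : I * ((-n + k : ℤ) : ℂ) ≠ 0 := by
      refine mul_ne_zero I_ne_zero ?_
      exact_mod_cast (by omega : -n + k ≠ 0)
    have := intervalIntegral.integral_eq_sub_of_hasDerivAt (a := 0) (b := 2 * π)
      (fun x _ => (hasDerivAt_ek (-n + k) x).div_const (I * ((-n + k : ℤ) : ℂ)))
      ((((continuous_ek _).const_mul _).div_const _).intervalIntegrable 0 (2 * π))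
    simp only [mul_div_cancel_left₀ _ hk] at this
    rw [this, show (2 * π : ℝ) = 0 + 2 * π by ring, ek_periodic]; simp

theorem fc_add {f g : ℝ → ℂ} (hf : IntervalIntegrable f volume 0 (2*π))
    (hg : IntervalIntegrable g volume 0 (2*π)) (k : ℤ) :
    fc (fun α => f α + g α) k = fc f k + fc g k := by
  simp only [fc_eq, mul_add]
  rw [intervalIntegral.integral_add (hf.continuousOn_mul (continuous_ek _).continuousOn)
    (hg.continuousOn_mul (continuous_ek _).continuousOn), mul_add]

theorem fc_const_mul (c : ℂ) (f : ℝ → ℂ) (k : ℤ) : fc (fun α => c * f α) k = c * fc f k := by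
  simp only [fc_eq, mul_left_comm _ c, intervalIntegral.integral_const_mul]

theorem fc_sum {ι : Type*} (S : Finset ι) {f : ι → ℝ → ℂ}
    (hf : ∀ i ∈ S, IntervalIntegrable (f i) volume 0 (2*π)) (k : ℤ) :
    fc (fun α => ∑ i ∈ S, f i α) k = ∑ i ∈ S, fc (f i) k := by
  simp only [fc_eq, Finset.mul_sum]
  rw [intervalIntegral.integral_finsetSum, Finset.mul_sum]
  exact fun i hi => (hf i hi).continuousOn_mul (continuous_ek _).continuousOn

theorem fc_congr_ae {f g : ℝ → ℂ} (h : ∀ᵐ x, x ∈ Set.Ioc 0 (2*π) → f x = g x) (k : ℤ) :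
    fc f k = fc g k := by
  rw [fc_eq, fc_eq]
  congr 1
  refine intervalIntegral.integral_congr_ae ?_
  rw [Set.uIoc_of_le Real.two_pi_pos.le]
  filter_upwards [h] with x hx hx'
  rw [hx hx']

theorem fc_conj (f : ℝ → ℂ) (k : ℤ) :
    fc (fun α => (starRingEnd ℂ) (f α)) k = (starRingEnd ℂ) (fc f (-k)) := by
  rw [fc_eq, fc_eq, map_mul, intervalIntegral.integral_of_le Real.two_pi_pos.le,
    intervalIntegral.integral_of_le Real.two_pi_pos.le, ← integral_conj]
  congr 1
  · simp [Complex.conj_ofNat]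
  · congr 1; ext x; rw [map_mul, ← ek_neg]; simp

theorem hasSum_fc_sq {f : ℝ → ℂ} (hf : MemLp f 2 (volume.restrict (Set.Ioc 0 (2*π)))) :
    HasSum (fun i => ‖fc f i‖ ^ 2) ((2*π)⁻¹ * ∫ x in (0:ℝ)..(2*π), ‖f x‖ ^ 2) := by
  simpa [fc_eq_fourierCoeffOn] using hasSum_sq_fourierCoeffOn Real.two_pi_pos hf

theorem Continuous.memLp_two {f : ℝ → ℂ} (hf : Continuous f) :
    MemLp f 2 (volume.restrict (Set.Ioc 0 (2*π))) := by
  obtain ⟨C, hC⟩ := isCompact_Icc.exists_bound_of_continuousOn (s := Set.Icc 0 (2*π)) hf.continuousOn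
  refine MemLp.of_bound hf.aestronglyMeasurable C ?_
  filter_upwards [ae_restrict_mem measurableSet_Ioc] with x hx
  exact hC x ⟨hx.1.le, hx.2⟩

theorem energy_zero_fc {f : ℝ → ℂ} (hf : MemLp f 2 (volume.restrict (Set.Ioc 0 (2*π)))) :
    energy 0 (fun n => ‖fc f n‖ₑ) =
      ENNReal.ofReal ((2*π)⁻¹ * ∫ x in (0:ℝ)..(2*π), ‖f x‖ ^ 2) := by
  rw [energy_zero_eq, ← (hasSum_fc_sq hf).tsum_eq,
    ENNReal.ofReal_tsum_of_nonneg (fun _ => by positivity) (hasSum_fc_sq hf).summable]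
  refine tsum_congr fun n => ?_
  rw [ENNReal.ofReal_pow (norm_nonneg _), ofReal_norm]

theorem energy_zero_fc_le {f g : ℝ → ℂ} (hf : Continuous f) (hg : Continuous g) {M : ℝ≥0}
    (h : ∀ x, ‖f x‖ ≤ M * ‖g x‖) :
    energy 0 (fun n => ‖fc f n‖ₑ) ≤ M ^ 2 * energy 0 (fun n => ‖fc g n‖ₑ) := by
  rw [energy_zero_fc (Continuous.memLp_two hf), energy_zero_fc (Continuous.memLp_two hg),
    ← ENNReal.coe_pow, ← ENNReal.ofReal_coe_nnreal, ← ENNReal.ofReal_mul (by positivity)]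
  refine ENNReal.ofReal_le_ofReal ?_
  rw [mul_left_comm]
  gcongr
  rw [← intervalIntegral.integral_const_mul]
  refine intervalIntegral.integral_mono_on Real.two_pi_pos.le
    (Continuous.intervalIntegrable (by fun_prop) _ _)
    (Continuous.intervalIntegrable (by fun_prop) _ _) fun x _ => ?_
  have := pow_le_pow_left₀ (norm_nonneg _) (h x) 2
  simpa [mul_pow] using this

theorem energy_zero_fc_le_sq {f : ℝ → ℂ} (hf : Continuous f) {M : ℝ≥0} (h : ∀ x, ‖f x‖ ≤ M) :
    energy 0 (fun n => ‖fc f n‖ₑ) ≤ M ^ 2 := by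
  refine (energy_zero_fc_le hf (continuous_ek 0) (M := M) (by simpa [norm_ek] using h)).trans_eq ?_
  rw [energy_zero_eq, tsum_eq_single 0]
  · simp [fc_ek]
  · intro n hn; simp [fc_ek, hn]

theorem norm_fc_le {f : ℝ → ℂ} {M : ℝ} (h : ∀ x, ‖f x‖ ≤ M) (n : ℤ) : ‖fc f n‖ ≤ M := by
  rw [fc_eq, norm_mul]
  have := intervalIntegral.norm_integral_le_of_norm_le_const (a := 0) (b := 2*π)
    (f := fun α => ek (-n) α * f α) (C := M) (fun x _ => by rw [norm_mul, norm_ek, one_mul]; exact h x)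
  have h2 : ‖1 / (2 * (π:ℂ))‖ = (2 * π)⁻¹ := by
    simp [abs_of_pos Real.pi_pos]
  rw [h2, inv_mul_le_iff₀ Real.two_pi_pos]
  simpa [abs_of_pos Real.pi_pos, mul_comm, mul_left_comm, mul_assoc] using this

/-- An integrable function all of whose Fourier coefficients vanish is zero. -/
theorem ae_eq_zero_of_fc_eq_zero {f : ℝ → ℂ} (hf : IntervalIntegrable f volume 0 (2*π))
    (h : ∀ k, fc f k = 0) : ∀ᵐ x, x ∈ Set.Ioc 0 (2*π) → f x = 0 := by
  have : Fact (0 < 2 * π) := ⟨Real.two_pi_pos⟩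
  have hint : ∀ g : C(AddCircle (2*π), ℂ),
      IntervalIntegrable (fun x : ℝ => f x * g (x : AddCircle (2*π))) volume 0 (2*π) := fun g =>
    hf.mul_continuousOn (g.continuous.comp (AddCircle.continuous_mk' _)).continuousOn
  let L : C(AddCircle (2*π), ℂ) →ₗ[ℂ] ℂ :=
    { toFun := fun g => ∫ x in (0:ℝ)..(2*π), f x * g (x : AddCircle (2*π))
      map_add' := fun g g' => by
        simp only [ContinuousMap.add_apply, mul_add]
        exact intervalIntegral.integral_add (hint g) (hint g')
      map_smul' := fun c g => by
        simp only [ContinuousMap.smul_apply, smul_eq_mul, mul_left_comm _ c,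
          intervalIntegral.integral_const_mul, RingHom.id_apply] }
  let L' := L.mkContinuous (∫ x in (0:ℝ)..(2*π), ‖f x‖) fun g => by
    refine (intervalIntegral.norm_integral_le_integral_norm Real.two_pi_pos.le).trans ?_
    rw [← intervalIntegral.integral_mul_const]
    refine intervalIntegral.integral_mono_on Real.two_pi_pos.le (hint g).norm
      (hf.norm.mul_const _) fun x _ => ?_
    rw [norm_mul]
    gcongr
    exact g.norm_coe_le_norm _
  have hker : ∀ g, L' g = 0 := fun g => by
    have : (Submodule.span ℂ (Set.range (@fourier (2*π)))).topologicalClosure ≤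
        LinearMap.ker (L' : C(AddCircle (2*π), ℂ) →ₗ[ℂ] ℂ) := by
      refine Submodule.topologicalClosure_minimal _ ?_ (L'.isClosed_ker)
      rw [Submodule.span_le]
      rintro _ ⟨n, rfl⟩
      change ∫ x in (0:ℝ)..(2*π), f x * fourier n (x : AddCircle (2*π)) = 0
      have h1 := h (-n)
      rw [fc_eq, neg_neg] at h1
      have hp : (1 / (2 * (π:ℂ))) ≠ 0 := by
        exact_mod_cast (one_div_pos.2 Real.two_pi_pos).ne'
      rw [← (mul_eq_zero.1 h1).resolve_left hp]
      refine intervalIntegral.integral_congr fun x _ => ?_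
      rw [fourier_coe_apply, ek, mul_comm]
      have : (π:ℂ) ≠ 0 := by exact_mod_cast Real.pi_ne_zero
      congr 2
      push_cast; field_simp
    rw [span_fourier_closure_eq_top] at this
    exact this (Submodule.mem_top (x := g))
  have key := isOpen_Ioo.ae_eq_zero_of_integral_contDiff_smul_eq_zero (U := Set.Ioo 0 (2*π))
    (f := f) (μ := volume)
    (((intervalIntegrable_iff_integrableOn_Ioc_of_le Real.two_pi_pos.le).1 hf).mono_set
      Set.Ioo_subset_Ioc_self).locallyIntegrableOn ?_
  · filter_upwards [key, Measure.ae_ne volume (2*π)] with x hx hx' hx''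
    exact hx ⟨hx''.1, lt_of_le_of_ne hx''.2 hx'⟩
  · intro g hg hgc hsupp
    have hg0 : ∀ x, x ∉ Set.Ioo 0 (2*π) → g x = 0 := fun x hx => by
      by_contra h'
      exact hx (hsupp (subset_tsupport g h'))
    let G : C(AddCircle (2*π), ℂ) := ⟨AddCircle.liftIco (2*π) 0 (fun x => (g x : ℂ)),
      AddCircle.liftIco_zero_continuous (by simp [hg0])
        (Complex.continuous_ofReal.comp hg.continuous).continuousOn⟩
    have h1 : ∫ x in (0:ℝ)..(2*π), f x * G (x : AddCircle (2*π)) = 0 := hker G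
    rw [intervalIntegral.integral_of_le Real.two_pi_pos.le] at h1
    rw [← setIntegral_eq_integral_of_forall_compl_eq_zero (s := Set.Ioc 0 (2*π)), ← h1,
      integral_Ioc_eq_integral_Ioo, integral_Ioc_eq_integral_Ioo]
    · refine setIntegral_congr_fun measurableSet_Ioo fun x hx => ?_
      change g x • f x = f x * AddCircle.liftIco (2*π) 0 (fun x => (g x : ℂ)) (x : AddCircle (2*π))
      rw [AddCircle.liftIco_zero_coe_apply ⟨hx.1.le, hx.2⟩, Complex.real_smul, mul_comm]
    · intro x hx
      rw [hg0 x fun h' => hx ⟨h'.1, h'.2.le⟩, zero_smul]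

theorem ae_eq_of_fc_eq {f g : ℝ → ℂ} (hf : IntervalIntegrable f volume 0 (2*π))
    (hg : IntervalIntegrable g volume 0 (2*π)) (h : ∀ k, fc f k = fc g k) :
    ∀ᵐ x, x ∈ Set.Ioc 0 (2*π) → f x = g x := by
  have := ae_eq_zero_of_fc_eq_zero (f := fun x => f x + (-1) * g x) (hf.add (hg.const_mul _))
    fun k => by rw [fc_add hf (hg.const_mul _), fc_const_mul, h]; ring
  filter_upwards [this] with x hx hx'
  linear_combination hx hx'

theorem summable_norm_of_tsum_enorm {c : ℤ → ℂ} (h : ∑' k, ‖c k‖ₑ ≠ ⊤) :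
    Summable fun k => ‖c k‖ :=
  NNReal.summable_coe.2 (ENNReal.tsum_coe_ne_top_iff_summable.1 h)

theorem summable_norm_of_energy {ρ : ℝ} (hρ : 1 ≤ ρ) {c : ℤ → ℂ}
    (h : energy ρ (fun n => ‖c n‖ₑ) ≠ ⊤) : Summable fun k => ‖c k‖ := by
  obtain ⟨C, hC⟩ := tsum_sq_le_energy_of_one_le
  refine summable_norm_of_tsum_enorm fun h' => ?_
  have := hC ρ hρ (fun n => ‖c n‖ₑ)
  rw [h'] at this
  exact (this.trans_lt (ENNReal.mul_lt_top ENNReal.coe_lt_top h.lt_top)).ne (by simp)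

/-- A square summable sequence of Fourier coefficients comes from a square integrable function. -/
theorem memLp_of_energy {f : ℝ → ℂ} (hf : IntervalIntegrable f volume 0 (2*π))
    (h : energy 0 (fun n => ‖fc f n‖ₑ) ≠ ⊤) : MemLp f 2 (volume.restrict (Set.Ioc 0 (2*π))) := by
  have : Fact (0 < 2 * π) := ⟨Real.two_pi_pos⟩
  have hmem : Memℓp (fc f) 2 := by
    rw [memℓp_gen_iff (by norm_num)]
    rw [energy_zero_eq] at h
    have h1 : ∀ n, ‖fc f n‖ₑ ^ 2 = ((‖fc f n‖₊ ^ 2 : ℝ≥0) : ℝ≥0∞) := fun n => by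
      rw [ENNReal.coe_pow]; rfl
    simp only [h1] at h
    have := NNReal.summable_coe.2 (ENNReal.tsum_coe_ne_top_iff_summable.1 h)
    simpa using this
  let g := (@fourierBasis (2*π) _).repr.symm ⟨fc f, hmem⟩
  have hg : ∀ n, fourierCoeff g n = fc f n := fun n => by
    rw [← fourierBasis_repr]
    simp [g]
  have hgL : MemLp (fun x : ℝ => g (x : AddCircle (2*π))) 2 (volume.restrict (Set.Ioc 0 (2*π))) := by
    have h1 : MemLp g 2 (volume : Measure (AddCircle (2*π))) :=
      memLp_haarAddCircle_iff.1 (Lp.memLp g)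
    have h2 := AddCircle.measurePreserving_mk (2*π) 0
    rw [zero_add] at h2
    exact h1.comp_measurePreserving h2
  have hgI : IntervalIntegrable (fun x : ℝ => g (x : AddCircle (2*π))) volume 0 (2*π) := by
    rw [intervalIntegrable_iff_integrableOn_Ioc_of_le Real.two_pi_pos.le]
    exact hgL.integrable (by norm_num)
  have hgc : ∀ n, fc (fun x : ℝ => g (x : AddCircle (2*π))) n = fc f n := fun n => by
    rw [← hg n, fourierCoeff_eq_intervalIntegral _ n 0, fc_eq, Complex.real_smul, zero_add]
    congr 1
    · push_cast; ring
    · refine intervalIntegral.integral_congr fun x _ => ?_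
      simp only [smul_eq_mul]
      rw [fourier_coe_apply, ek]
      have : (π:ℂ) ≠ 0 := by exact_mod_cast Real.pi_ne_zero
      congr 2
      push_cast; field_simp; try ring
  have hae := ae_eq_of_fc_eq hgI hf hgc
  exact hgL.ae_eq ((ae_restrict_iff' measurableSet_Ioc).2 hae)

theorem lintegral_sq_le_energy {f : ℝ → ℂ} (hf : IntervalIntegrable f volume 0 (2*π)) :
    (∫⁻ x in Set.Ioc 0 (2*π), ‖f x‖ₑ) ^ 2 ≤
      ENNReal.ofReal (2*π) ^ 2 * energy 0 (fun n => ‖fc f n‖ₑ) := by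
  by_cases h : energy 0 (fun n => ‖fc f n‖ₑ) = ⊤
  · rw [h, ENNReal.mul_top]
    · exact le_top
    · exact pow_ne_zero _ (by simpa using Real.pi_pos)
  have hL := memLp_of_energy hf h
  have h1 := lintegral_mul_sq_le (μ := volume.restrict (Set.Ioc 0 (2*π))) (x := fun _ => 1)
    (y := fun x => ‖f x‖ₑ) aemeasurable_const hL.aestronglyMeasurable.enorm
  simp only [one_mul, lintegral_const, Measure.restrict_apply MeasurableSet.univ, Set.univ_inter,
    Real.volume_Ioc, sub_zero] at h1
  refine h1.trans_eq ?_
  rw [energy_zero_fc hL, sq, mul_assoc]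
  congr 1
  rw [intervalIntegral.integral_of_le Real.two_pi_pos.le, ← ENNReal.ofReal_mul Real.two_pi_pos.le,
    ← mul_assoc, mul_inv_cancel₀ Real.two_pi_pos.ne', one_mul,
    ofReal_integral_eq_lintegral_ofReal hL.integrable_norm_pow' (ae_of_all _ fun _ => by positivity)]
  refine lintegral_congr fun x => ?_
  rw [ENNReal.ofReal_pow (norm_nonneg _), ofReal_norm]

/-- The sum of an absolutely convergent trigonometric series. -/
def wser (c : ℤ → ℂ) (α : ℝ) : ℂ := ∑' k, c k * ek k α

theorem norm_mul_ek (c : ℂ) (k : ℤ) (α : ℝ) : ‖c * ek k α‖ = ‖c‖ := by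
  rw [norm_mul, norm_ek, mul_one]

section
variable {c : ℤ → ℂ} (hc : Summable fun k => ‖c k‖)
include hc

theorem hasSum_wser (α : ℝ) : HasSum (fun k => c k * ek k α) (wser c α) :=
  (Summable.of_norm (by simpa only [norm_mul_ek] using hc)).hasSum

theorem continuous_wser : Continuous (wser c) :=
  continuous_tsum (fun k => (continuous_ek k).const_mul _) hc fun _ _ => (norm_mul_ek _ _ _).le

theorem hasSum_fc_wser_mul {v : ℝ → ℂ} (hv : IntervalIntegrable v volume 0 (2*π)) (n : ℤ) :
    HasSum (fun k => c k * fc v (n - k)) (fc (fun α => wser c α * v α) n) := by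
  have hm : ∀ k : ℤ, IntervalIntegrable (fun α => ek (-n) α * (c k * ek k α * v α)) volume 0 (2*π) :=
    fun k => (hv.continuousOn_mul ((continuous_ek k).const_mul _).continuousOn).continuousOn_mul
      (continuous_ek _).continuousOn
  have key := intervalIntegral.hasSum_integral_of_dominated_convergence (a := 0) (b := 2*π)
    (μ := volume) (F := fun (k : ℤ) α => ek (-n) α * (c k * ek k α * v α))
    (f := fun α => ek (-n) α * (wser c α * v α))
    (fun k α => ‖c k‖ * ‖v α‖) (fun k => (hm k).def'.aestronglyMeasurable)
    (fun k => ae_of_all _ fun α _ => by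
      rw [norm_mul, norm_ek, one_mul, norm_mul, norm_mul_ek])
    (ae_of_all _ fun α _ => hc.mul_right _)
    (by simp only [tsum_mul_right]; exact hv.norm.const_mul _)
    (ae_of_all _ fun α _ => ((hasSum_wser hc α).mul_right _).mul_left _)
  have h2 := key.mul_left (1 / (2 * (π : ℂ)))
  rw [fc_eq]
  refine h2.congr_fun fun k => ?_
  rw [fc_eq, mul_left_comm, ← intervalIntegral.integral_const_mul (c k)]
  congr 2; ext α
  rw [show -(n - k) = -n + k by ring, ek_add]; ring

theorem fc_wser (n : ℤ) : fc (wser c) n = c n := by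
  have h := hasSum_fc_wser_mul hc (v := ek 0) ((continuous_ek 0).intervalIntegrable _ _) n
  simp only [ek_zero, mul_one, fc_ek] at h
  rw [← h.tsum_eq, tsum_eq_single n]
  · simp
  · intro k hk; rw [if_neg (by omega), mul_zero]
end

theorem wser_periodic (c : ℤ → ℂ) : Function.Periodic (wser c) (2*π) := fun α => by
  unfold wser; simp only [ek_periodic _ α]

theorem ae_eq_wser {u : ℝ → ℂ} (hu : IntervalIntegrable u volume 0 (2*π))
    (h : Summable fun k => ‖fc u k‖) : ∀ᵐ x, x ∈ Set.Ioc 0 (2*π) → u x = wser (fc u) x :=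
  ae_eq_of_fc_eq hu ((continuous_wser h).intervalIntegrable _ _) fun k => (fc_wser h k).symm

theorem eq_of_ae_eq_of_periodic {f g : ℝ → ℂ} (hf : Continuous f) (hg : Continuous g)
    (pf : Function.Periodic f (2*π)) (pg : Function.Periodic g (2*π))
    (h : ∀ᵐ x, x ∈ Set.Ioc 0 (2*π) → f x = g x) : f = g := by
  have h1 := Measure.eqOn_Ioc_of_ae_eq (μ := volume)
    ((ae_restrict_iff' measurableSet_Ioc).2 h) hf.continuousOn hg.continuousOn
  have p : Function.Periodic (fun x => f x - g x) (2*π) := fun x => by simp only [pf x, pg x]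
  ext x
  obtain ⟨y, hy, hxy⟩ := p.exists_mem_Ioc Real.two_pi_pos x 0
  rw [zero_add] at hy
  rw [← sub_eq_zero, hxy, h1 hy, sub_self]

theorem eq_wser {u : ℝ → ℂ} (hu : Continuous u) (pu : Function.Periodic u (2*π))
    (h : Summable fun k => ‖fc u k‖) : u = wser (fc u) :=
  eq_of_ae_eq_of_periodic hu (continuous_wser h) pu (wser_periodic _)
    (ae_eq_wser (hu.intervalIntegrable _ _) h)

theorem enorm_fc_mul_le {u v : ℝ → ℂ} (hu : IntervalIntegrable u volume 0 (2*π))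
    (hv : IntervalIntegrable v volume 0 (2*π)) (h : Summable fun k => ‖fc u k‖) (n : ℤ) :
    ‖fc (fun α => u α * v α) n‖ₑ ≤ ∑' m, ‖fc u (n - m)‖ₑ * ‖fc v m‖ₑ := by
  have h1 : fc (fun α => u α * v α) n = fc (fun α => wser (fc u) α * v α) n := by
    refine fc_congr_ae ?_ n
    filter_upwards [ae_eq_wser hu h] with x hx hx'
    rw [hx hx']
  rw [h1, ← (hasSum_fc_wser_mul h hv n).tsum_eq]
  refine (enorm_tsum_le_tsum_enorm).trans_eq ?_
  rw [← (Equiv.subLeft n).tsum_eq]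
  refine tsum_congr fun m => ?_
  simp [enorm_mul]

theorem energy_fc_mul (R : ℝ) : ∃ C : ℝ≥0, ∀ σ ρ : ℝ, 0 ≤ σ → σ ≤ ρ → 1 ≤ ρ → ρ ≤ R →
    ∀ u v : ℝ → ℂ, IntervalIntegrable u volume 0 (2*π) → IntervalIntegrable v volume 0 (2*π) →
      energy ρ (fun n => ‖fc u n‖ₑ) ≠ ⊤ →
      energy σ (fun n => ‖fc (fun α => u α * v α) n‖ₑ) ≤
        C * (energy ρ (fun n => ‖fc u n‖ₑ) * energy σ (fun n => ‖fc v n‖ₑ)) := by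
  obtain ⟨C, hC⟩ := energy_conv R
  exact ⟨C, fun σ ρ h1 h2 h3 h4 u v hu hv h => hC σ ρ h1 h2 h3 h4 _ _ _
    fun n => enorm_fc_mul_le hu hv (summable_norm_of_energy h3 h) n⟩

theorem fc_deriv {u u' : ℝ → ℂ} (hu : ∀ x, HasDerivAt u (u' x) x) (hu' : Continuous u')
    (pu : Function.Periodic u (2*π)) (n : ℤ) : fc u' n = I * n * fc u n := by
  have hc : Continuous u := continuous_iff_continuousAt.2 fun x => (hu x).continuousAt
  have h := intervalIntegral.integral_mul_deriv_eq_deriv_mul (a := 0) (b := 2*π)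
    (fun x _ => hasDerivAt_ek (-n) x) (fun x _ => hu x)
    (((continuous_ek (-n)).const_mul _).intervalIntegrable _ _) (hu'.intervalIntegrable _ _)
  have e1 : u (2*π) = u 0 := by simpa using pu 0
  have e2 : ek (-n) (2*π) = ek (-n) 0 := by simpa using ek_periodic (-n) 0
  rw [fc_eq, h, e1, e2, sub_self, zero_sub, fc_eq, mul_left_comm]
  simp only [mul_assoc (I * ((-n : ℤ) : ℂ)), intervalIntegral.integral_const_mul]
  push_cast; ring

theorem enorm_fc_deriv {u u' : ℝ → ℂ} (hu : ∀ x, HasDerivAt u (u' x) x) (hu' : Continuous u')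
    (pu : Function.Periodic u (2*π)) (n : ℤ) :
    ‖fc u' n‖ₑ = (n.natAbs : ℝ≥0∞) * ‖fc u n‖ₑ := by
  rw [fc_deriv hu hu' pu, enorm_mul, enorm_mul]
  have : ‖(n:ℂ)‖ₑ = (n.natAbs : ℝ≥0∞) := by
    rw [← ofReal_norm, Complex.norm_intCast, ← Int.cast_abs, ← Nat.cast_natAbs,
      ENNReal.ofReal_natCast]
  rw [this]; simp [enorm_eq_nnnorm]

theorem energy_succ_le {u u' : ℝ → ℂ} (hu : ∀ x, HasDerivAt u (u' x) x) (hu' : Continuous u')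
    (pu : Function.Periodic u (2*π)) (σ : ℝ) :
    energy (σ + 1) (fun n => ‖fc u n‖ₑ) ≤
      4 * (energy 0 (fun n => ‖fc u n‖ₑ) + energy σ (fun n => ‖fc u' n‖ₑ)) := by
  simp only [enorm_fc_deriv hu hu' pu]
  exact energy_add_one_le _ _

theorem energy_fc_pow_mul (R : ℝ) : ∃ C : ℝ≥0, ∀ σ ρ : ℝ, 0 ≤ σ → σ ≤ ρ → 1 ≤ ρ → ρ ≤ R →
    ∀ (q : ℕ) (v w : ℝ → ℂ), Continuous v → Continuous w →
      energy ρ (fun n => ‖fc v n‖ₑ) ≠ ⊤ →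
      energy σ (fun n => ‖fc (fun α => v α ^ q * w α) n‖ₑ) ≤
        (C * energy ρ (fun n => ‖fc v n‖ₑ)) ^ q * energy σ (fun n => ‖fc w n‖ₑ) := by
  obtain ⟨C, hC⟩ := energy_fc_mul R
  refine ⟨C, fun σ ρ h1 h2 h3 h4 q v w hv hw h => ?_⟩
  induction q with
  | zero => simp
  | succ q ih =>
    have := hC σ ρ h1 h2 h3 h4 v (fun α => v α ^ q * w α) (hv.intervalIntegrable _ _)
      (Continuous.intervalIntegrable (by fun_prop) _ _) h
    simp only [pow_succ', mul_assoc]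
    refine this.trans ?_
    rw [mul_left_comm (energy ρ _), mul_left_comm]
    calc _ ≤ C * (energy ρ (fun n => ‖fc v n‖ₑ) *
          ((C * energy ρ (fun n => ‖fc v n‖ₑ)) ^ q * energy σ (fun n => ‖fc w n‖ₑ))) := by
          rw [mul_left_comm]; gcongr
      _ = _ := by ring

/-- Regularity bootstrap: if `v' = κ v^q u'` with `v` bounded, then Sobolev bounds on `u` transfer
to `v`. -/
theorem energy_bootstrap {R : ℝ} (hR : 1 ≤ R) (q : ℕ) (M : ℝ≥0) :
    ∃ (C : ℝ≥0) (p : ℕ), ∀ (u u' v : ℝ → ℂ) (κ : ℂ), (∀ x, HasDerivAt u (u' x) x) →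
      Continuous u' → Function.Periodic u (2*π) →
      (∀ x, HasDerivAt v (κ * (v x ^ q * u' x)) x) → Function.Periodic v (2*π) →
      ‖κ‖ ≤ 1 → (∀ x, ‖v x‖ ≤ M) → energy R (fun n => ‖fc u n‖ₑ) ≠ ⊤ →
      energy R (fun n => ‖fc v n‖ₑ) ≤ C * (1 + energy R (fun n => ‖fc u n‖ₑ)) ^ p := by
  suffices h : ∀ j : ℕ, ∃ (C : ℝ≥0) (p : ℕ), ∀ (u u' v : ℝ → ℂ) (κ : ℂ),
      (∀ x, HasDerivAt u (u' x) x) →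
      Continuous u' → Function.Periodic u (2*π) →
      (∀ x, HasDerivAt v (κ * (v x ^ q * u' x)) x) → Function.Periodic v (2*π) →
      ‖κ‖ ≤ 1 → (∀ x, ‖v x‖ ≤ M) → energy R (fun n => ‖fc u n‖ₑ) ≠ ⊤ →
      energy (min (j + 1) R) (fun n => ‖fc v n‖ₑ) ≤
        C * (1 + energy R (fun n => ‖fc u n‖ₑ)) ^ p by
    obtain ⟨j, hj⟩ := exists_nat_ge R
    obtain ⟨C, p, h⟩ := h j
    rw [min_eq_right (by linarith)] at h
    exact ⟨C, p, h⟩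
  obtain ⟨K, hK⟩ := energy_fc_pow_mul R
  intro j
  induction j with
  | zero =>
    refine ⟨4 * (M ^ 2 + (M ^ q) ^ 2), 1, fun u u' v κ hu hu' pu hv pv hκ hM hE => ?_⟩
    have cv : Continuous v := continuous_iff_continuousAt.2 fun x => (hv x).continuousAt
    have cv' : Continuous (fun x => κ * (v x ^ q * u' x)) := by fun_prop
    rw [Nat.cast_zero, zero_add, min_eq_left hR]
    have h1 := energy_succ_le hv cv' pv 0
    rw [zero_add] at h1
    refine h1.trans ?_
    have h2 := energy_zero_fc_le_sq cv hM
    have h3 := energy_zero_fc_le cv' hu' (M := M ^ q) fun x => by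
      rw [norm_mul, norm_mul, norm_pow]
      calc _ ≤ 1 * ((M:ℝ) ^ q * ‖u' x‖) := by gcongr; exact hM x
        _ = _ := by push_cast; ring
    have h4 : energy 0 (fun n => ‖fc u' n‖ₑ) ≤ energy R (fun n => ‖fc u n‖ₑ) := by
      simp only [enorm_fc_deriv hu hu' pu]
      exact (energy_natAbs_le _ _).trans (energy_mono_exp (by linarith) _)
    set E := energy R (fun n => ‖fc u n‖ₑ)
    calc _ ≤ 4 * ((M:ℝ≥0∞) ^ 2 + ((M ^ q : ℝ≥0) : ℝ≥0∞) ^ 2 * E) := by gcongr; exact h3.trans (by gcongr)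
      _ ≤ 4 * ((M:ℝ≥0∞) ^ 2 * (1 + E) + ((M ^ q : ℝ≥0) : ℝ≥0∞) ^ 2 * (1 + E)) := by
        gcongr
        · exact le_mul_of_one_le_right' le_self_add
        · exact le_add_self
      _ = _ := by push_cast; ring
  | succ j ih =>
    obtain ⟨C, p, ih⟩ := ih
    refine ⟨4 * (M ^ 2 + (K * C) ^ q), p * q + 1, fun u u' v κ hu hu' pu hv pv hκ hM hE => ?_⟩
    have ih := ih u u' v κ hu hu' pu hv pv hκ hM hE
    have cv : Continuous v := continuous_iff_continuousAt.2 fun x => (hv x).continuousAt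
    have cv' : Continuous (fun x => κ * (v x ^ q * u' x)) := by fun_prop
    set ρ : ℝ := min (j + 1) R with hρ
    obtain ⟨σ, hσ⟩ : ∃ σ : ℝ, min (((j + 1 : ℕ) : ℝ) + 1) R = σ + 1 := ⟨_ - 1, by ring⟩
    have hj : (0:ℝ) ≤ j := j.cast_nonneg
    have a1 : 0 ≤ σ := by
      have : 1 ≤ min (((j + 1 : ℕ) : ℝ) + 1) R := le_min (by push_cast; linarith) hR
      linarith
    have a2 : σ ≤ ρ := by
      have x1 := min_le_left (((j + 1 : ℕ) : ℝ) + 1) R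
      have x2 := min_le_right (((j + 1 : ℕ) : ℝ) + 1) R
      push_cast at x1 x2 hσ
      exact le_min (by linarith) (by linarith)
    have a3 : 1 ≤ ρ := le_min (by linarith) hR
    have a4 : σ + 1 ≤ R := hσ ▸ min_le_right _ _
    have hEρ : energy ρ (fun n => ‖fc v n‖ₑ) ≠ ⊤ := by
      refine (ih.trans_lt (ENNReal.mul_lt_top ENNReal.coe_lt_top (ENNReal.pow_lt_top ?_))).ne
      exact ENNReal.add_lt_top.2 ⟨ENNReal.one_lt_top, hE.lt_top⟩
    have h2 := energy_zero_fc_le_sq cv hM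
    have h3 : energy σ (fun n => ‖fc u' n‖ₑ) ≤ energy R (fun n => ‖fc u n‖ₑ) := by
      simp only [enorm_fc_deriv hu hu' pu]
      exact (energy_natAbs_le _ _).trans (energy_mono_exp a4 _)
    have h4 := hK σ ρ a1 a2 a3 (min_le_right _ _) q v u' cv hu' hEρ
    have h5 : energy σ (fun n => ‖fc (fun x => κ * (v x ^ q * u' x)) n‖ₑ) ≤
        energy σ (fun n => ‖fc (fun x => v x ^ q * u' x) n‖ₑ) := energy_mono fun n => by
      rw [fc_const_mul, enorm_mul]
      refine mul_le_of_le_one_left' ?_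
      rw [← ofReal_norm]; exact ENNReal.ofReal_le_one.2 hκ
    rw [hσ]
    set E := energy R (fun n => ‖fc u n‖ₑ)
    calc _ ≤ _ := energy_succ_le hv cv' pv σ
      _ ≤ 4 * ((M:ℝ≥0∞) ^ 2 + (K * (C * (1 + E) ^ p)) ^ q * E) := by
        gcongr
        refine h5.trans (h4.trans ?_)
        gcongr
      _ ≤ 4 * ((M:ℝ≥0∞) ^ 2 * (1 + E) ^ (p * q + 1) + (K * (C * (1 + E) ^ p)) ^ q * (1 + E)) := by
        gcongr
        · exact le_mul_of_one_le_right' (one_le_pow₀ le_self_add)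
        · exact le_add_self
      _ = _ := by push_cast; ring

theorem sum_Ico_int_sub (T : ℤ → ℂ) {a b : ℤ} (h : a ≤ b) :
    ∑ n ∈ Finset.Ico a b, (T (n + 1) - T n) = T b - T a := by
  induction b, h using Int.leInduction with
  | base => simp
  | succ b hb ih =>
    rw [← Finset.insert_Ico_right_eq_Ico_add_one hb, Finset.sum_insert (by simp), ih]; ring

/-- The modes occurring in `(e^{ikα} - e^{ikβ}) / (e^{iα} - e^{iβ})`. -/
def modes (k : ℤ) : Finset ℤ := Finset.Ico (min 0 k) (max 0 k)

theorem natAbs_le_of_mem_modes {n k : ℤ} (h : n ∈ modes k) :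
    n.natAbs ≤ k.natAbs ∧ (k - 1 - n).natAbs ≤ k.natAbs := by
  rw [modes, Finset.mem_Ico] at h; omega

theorem card_modes (k : ℤ) : (modes k).card = k.natAbs := by
  rw [modes, Int.card_Ico]; omega

/-- The divided difference of `e^{ikα}` with respect to `e^{iα}`, with a Fourier multiplier `m`. -/
def dker (m : ℤ → ℤ → ℂ) (k : ℤ) (α β : ℝ) : ℂ :=
  ∑ n ∈ modes k, (k.sign : ℂ) * m n (k - 1 - n) * (ek n α * ek (k - 1 - n) β)

theorem dker_one_mul (k : ℤ) (α β : ℝ) :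
    dker (fun _ _ => 1) k α β * (ek 1 α - ek 1 β) = ek k α - ek k β := by
  have h := sum_Ico_int_sub (fun n => ek n α * ek (k - n) β) (a := min 0 k) (b := max 0 k)
    (by omega)
  have h2 : dker (fun _ _ => 1) k α β * (ek 1 α - ek 1 β) = (k.sign : ℂ) *
      ∑ n ∈ Finset.Ico (min 0 k) (max 0 k),
        (ek (n + 1) α * ek (k - (n + 1)) β - ek n α * ek (k - n) β) := by
    rw [dker, Finset.sum_mul, Finset.mul_sum, modes]
    refine Finset.sum_congr rfl fun n _ => ?_
    have e1 : ek (k - n) β = ek (k - 1 - n) β * ek 1 β := by rw [← ek_add]; congr 1; ring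
    rw [ek_add n 1, e1, show k - (n + 1) = k - 1 - n by ring]; ring
  rw [h2, h]
  rcases lt_trichotomy k 0 with hk | rfl | hk
  · rw [Int.sign_eq_neg_one_of_neg hk, max_eq_left hk.le, min_eq_right hk.le]; simp [ek_zero]
  · rw [Int.sign_zero, Int.cast_zero, zero_mul, sub_eq_zero.2 (by simp only [ek_zero])]
  · rw [Int.sign_eq_one_of_pos hk, max_eq_right hk.le, min_eq_left hk.le]; simp [ek_zero]

theorem norm_dker_le {m : ℤ → ℤ → ℂ} {k : ℤ} {C : ℝ}
    (h : ∀ n ∈ modes k, ‖m n (k - 1 - n)‖ ≤ C) (α β : ℝ) : ‖dker m k α β‖ ≤ |(k:ℝ)| * C := by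
  refine (norm_sum_le_of_le _ (f := fun n => (k.sign : ℂ) * m n (k - 1 - n) *
    (ek n α * ek (k - 1 - n) β)) (n := fun _ => C) fun n hn => ?_).trans ?_
  · rw [norm_mul, norm_mul, norm_mul, norm_ek, norm_ek, mul_one, mul_one]
    have : ‖(k.sign : ℂ)‖ ≤ 1 := by
      rcases lt_trichotomy k 0 with hk | rfl | hk
      · simp [Int.sign_eq_neg_one_of_neg hk]
      · simp
      · simp [Int.sign_eq_one_of_pos hk]
    exact (mul_le_of_le_one_left (norm_nonneg _) this).trans (h n hn)
  · rw [Finset.sum_const, card_modes, nsmul_eq_mul, Nat.cast_natAbs, Int.cast_abs]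

theorem hasDerivAt_dker_left (m : ℤ → ℤ → ℂ) (k : ℤ) (α β : ℝ) :
    HasDerivAt (fun α => dker m k α β) (dker (fun n l => I * n * m n l) k α β) α := by
  refine HasDerivAt.fun_sum fun n _ => ?_
  have := (((hasDerivAt_ek n α).mul_const (ek (k - 1 - n) β)).const_mul
    ((k.sign : ℂ) * m n (k - 1 - n)))
  refine this.congr_deriv ?_
  ring

theorem hasDerivAt_dker_right (m : ℤ → ℤ → ℂ) (k : ℤ) (α β : ℝ) :
    HasDerivAt (fun β => dker m k α β) (dker (fun n l => I * l * m n l) k α β) β := by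
  refine HasDerivAt.fun_sum fun n _ => ?_
  have := (((hasDerivAt_ek (k - 1 - n) β).const_mul (ek n α)).const_mul
    ((k.sign : ℂ) * m n (k - 1 - n)))
  refine this.congr_deriv ?_
  ring

theorem dker_deriv_mul (k : ℤ) (α β : ℝ) :
    dker (fun _ l => I * l * 1) k α β * (ek 1 α - ek 1 β) =
      I * ek 1 β * dker (fun _ _ => 1) k α β - I * k * ek k β := by
  have h1 := ((hasDerivAt_dker_right (fun _ _ => 1) k α β).mul
    ((hasDerivAt_ek 1 β).const_sub (ek 1 α)))
  have h2 : HasDerivAt (fun β => ek k α - ek k β) (-(I * k * ek k β)) β :=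
    (hasDerivAt_ek k β).const_sub _
  have h3 := h1.unique (h2.congr_of_eventuallyEq
    (Eventually.of_forall fun β => dker_one_mul k α β))
  push_cast at h3
  linear_combination h3

theorem norm_dker_deriv_le (k : ℤ) (α β : ℝ) :
    ‖dker (fun _ l => I * l * 1) k α β‖ ≤ |(k:ℝ)| * |(k:ℝ)| := by
  refine norm_dker_le (fun n hn => ?_) α β
  have := (natAbs_le_of_mem_modes hn).2
  rw [mul_one, norm_mul, norm_I, one_mul, Complex.norm_intCast]
  rw [← Int.cast_abs, ← Int.cast_abs, Int.abs_eq_natAbs, Int.abs_eq_natAbs]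
  exact_mod_cast this

/-- The divided difference of `∑_{k ∈ S} a_k e^{ikα}` with respect to `e^{iα}`, with a Fourier
multiplier `m`. -/
def qker (S : Finset ℤ) (a : ℤ → ℂ) (m : ℤ → ℤ → ℂ) (α β : ℝ) : ℂ :=
  ∑ k ∈ S, a k * dker m k α β

theorem hasDerivAt_qker_left (S : Finset ℤ) (a : ℤ → ℂ) (m : ℤ → ℤ → ℂ) (α β : ℝ) :
    HasDerivAt (fun α => qker S a m α β) (qker S a (fun n l => I * n * m n l) α β) α :=
  HasDerivAt.fun_sum fun k _ => (hasDerivAt_dker_left m k α β).const_mul _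

theorem hasDerivAt_qker_right (S : Finset ℤ) (a : ℤ → ℂ) (m : ℤ → ℤ → ℂ) (α β : ℝ) :
    HasDerivAt (fun β => qker S a m α β) (qker S a (fun n l => I * l * m n l) α β) β :=
  HasDerivAt.fun_sum fun k _ => (hasDerivAt_dker_right m k α β).const_mul _

theorem continuous_qker (S : Finset ℤ) (a : ℤ → ℂ) (m : ℤ → ℤ → ℂ) :
    Continuous (fun p : ℝ × ℝ => qker S a m p.1 p.2) := by
  unfold qker dker
  have := continuous_ek
  fun_prop

theorem qker_periodic_left (S : Finset ℤ) (a : ℤ → ℂ) (m : ℤ → ℤ → ℂ) (β : ℝ) :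
    Function.Periodic (fun α => qker S a m α β) (2*π) := fun α => by
  simp only [qker, dker, ek_periodic _ α]

theorem qker_periodic_right (S : Finset ℤ) (a : ℤ → ℂ) (m : ℤ → ℤ → ℂ) (α : ℝ) :
    Function.Periodic (fun β => qker S a m α β) (2*π) := fun β => by
  simp only [qker, dker, ek_periodic _ β]

theorem fc_qker (S : Finset ℤ) (a : ℤ → ℂ) (m : ℤ → ℤ → ℂ) (β : ℝ) (n : ℤ) :
    fc (fun α => qker S a m α β) n = ∑ k ∈ S, a k *
      if n ∈ modes k then (k.sign : ℂ) * m n (k - 1 - n) * ek (k - 1 - n) β else 0 := by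
  have hc : ∀ k, Continuous fun α => dker m k α β := fun k => by
    unfold dker
    have := continuous_ek
    fun_prop
  unfold qker
  rw [fc_sum _ fun k _ => ((hc k).const_mul _).intervalIntegrable _ _]
  refine Finset.sum_congr rfl fun k _ => ?_
  rw [fc_const_mul]
  congr 1
  have h1 : ∀ α, dker m k α β = ∑ j ∈ modes k,
      ((k.sign : ℂ) * m j (k - 1 - j) * ek (k - 1 - j) β) * ek j α := fun α =>
    Finset.sum_congr rfl fun j _ => by ring
  simp only [h1]
  rw [fc_sum _ fun j _ => ((continuous_ek j).const_mul _).intervalIntegrable _ _]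
  simp only [fc_const_mul, fc_ek, mul_ite, mul_one, mul_zero, Finset.sum_ite_eq]

theorem enorm_fc_qker_le (S : Finset ℤ) (a : ℤ → ℂ) (m : ℤ → ℤ → ℂ) (y : ℤ → ℝ≥0∞)
    (h : ∀ k, ∀ n ∈ modes k, ‖a k‖ₑ * ‖m n (k - 1 - n)‖ₑ ≤ y k) (β : ℝ) (n : ℤ) :
    ‖fc (fun α => qker S a m α β) n‖ₑ ≤ ∑' k : ℤ, if n.natAbs ≤ k.natAbs then y k else 0 := by
  rw [fc_qker]
  refine (enorm_sum_le _ _).trans (le_trans (Finset.sum_le_sum fun k _ => ?_)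
    (ENNReal.sum_le_tsum S))
  by_cases hn : n ∈ modes k
  · rw [if_pos hn, if_pos (natAbs_le_of_mem_modes hn).1, enorm_mul, enorm_mul, enorm_mul, enorm_ek,
      mul_one]
    refine le_trans ?_ (h k n hn)
    gcongr
    refine mul_le_of_le_one_left' ?_
    rcases lt_trichotomy k 0 with hk | rfl | hk
    · simp [Int.sign_eq_neg_one_of_neg hk]
    · simp
    · simp [Int.sign_eq_one_of_pos hk]
  · simp [if_neg hn]

theorem enorm_intCast (n : ℤ) : ‖(n:ℂ)‖ₑ = (n.natAbs : ℝ≥0∞) := by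
  rw [← ofReal_norm, Complex.norm_intCast, ← Int.cast_abs, ← Nat.cast_natAbs,
    ENNReal.ofReal_natCast]

theorem enorm_I : ‖I‖ₑ = 1 := by simp [enorm_eq_nnnorm]

theorem continuous_qker_left (S : Finset ℤ) (a : ℤ → ℂ) (m : ℤ → ℤ → ℂ) (β : ℝ) :
    Continuous (fun α => qker S a m α β) :=
  continuous_iff_continuousAt.2 fun α => (hasDerivAt_qker_left S a m α β).continuousAt

theorem hasDerivAt_inv_qker {S : Finset ℤ} {a : ℤ → ℂ} {α β : ℝ}
    (hQ : qker S a (fun _ _ => 1) α β ≠ 0) :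
    HasDerivAt (fun α => (qker S a (fun _ _ => 1) α β)⁻¹)
      (-1 * ((qker S a (fun _ _ => 1) α β)⁻¹ ^ 2 * qker S a (fun n _ => I * n * 1) α β)) α := by
  refine ((hasDerivAt_qker_left S a (fun _ _ => 1) α β).inv hQ).congr_deriv ?_
  field_simp

theorem energy_kernel_le {s : ℝ} (hs : 2 ≤ s) : ∃ (C : ℝ≥0) (p : ℕ),
    ∀ (S : Finset ℤ) (a b : ℤ → ℂ) (m : ℤ → ℤ → ℂ), (∀ k, ‖a k‖ₑ ≤ ‖b k‖ₑ) →
      (∀ k, (k.natAbs : ℝ≥0∞) * ‖a k‖ₑ ≤ ‖b k‖ₑ) →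
      energy (s - 1) (fun n => ‖b n‖ₑ) ≠ ⊤ →
      (∀ α β, 1 / 16 ≤ ‖qker S a (fun _ _ => 1) α β‖) →
      (∀ k, ∀ n ∈ modes k, ‖m n (k - 1 - n)‖ₑ ≤ k.natAbs) →
      ∀ β, energy (s - 2) (fun n => ‖fc (fun α => (qker S a (fun _ _ => 1) α β)⁻¹ *
        qker S a m α β) n‖ₑ) ≤ C * (1 + energy (s - 1) (fun n => ‖b n‖ₑ)) ^ p := by
  obtain ⟨C₁, p, h₁⟩ := energy_bootstrap (R := s - 1) (by linarith) 2 16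
  obtain ⟨C₂, h₂⟩ := energy_fc_mul (s - 1)
  refine ⟨C₂ * C₁ * 384 ^ p * 48, p + 1, fun S a b m ha0 ha hE hQ hm β => ?_⟩
  set E := energy (s - 1) (fun n => ‖b n‖ₑ)
  have ha' : energy (s - 1) (fun n => (n.natAbs : ℝ≥0∞) * ‖a n‖ₑ) ≤ E := energy_mono ha
  have has : energy s (fun n => ‖a n‖ₑ) ≤ 8 * E := by
    have := energy_add_one_le (s - 1) (fun n => ‖a n‖ₑ)
    rw [sub_add_cancel] at this
    refine this.trans ?_
    have h0 : energy 0 (fun n => ‖a n‖ₑ) ≤ E :=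
      (energy_mono ha0).trans (energy_mono_exp (by linarith) _)
    calc _ ≤ 4 * (E + E) := by gcongr
      _ = _ := by ring
  have hQE : energy (s - 1) (fun n => ‖fc (fun α => qker S a (fun _ _ => 1) α β) n‖ₑ) ≤
      384 * E := by
    have := energy_hardy (ρ := s - 1) (by linarith)
      (enorm_fc_qker_le S a (fun _ _ => 1) (fun k => ‖a k‖ₑ) (fun k n _ => by simp) β)
    rw [sub_add_cancel] at this
    calc _ ≤ _ := this
      _ ≤ 48 * (8 * E) := by gcongr
      _ = _ := by ring
  have hmE : energy (s - 2) (fun n => ‖fc (fun α => qker S a m α β) n‖ₑ) ≤ 48 * E := by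
    have := energy_hardy (ρ := s - 2) (by linarith)
      (enorm_fc_qker_le S a m (fun k => ‖b k‖ₑ) (fun k n hn => by
        refine le_trans ?_ (ha k)
        rw [mul_comm]; gcongr; exact hm k n hn) β)
    rwa [show s - 2 + 1 = s - 1 by ring] at this
  have hQ0 : ∀ α β, qker S a (fun _ _ => 1) α β ≠ 0 := fun α β h => by
    have := hQ α β
    rw [h, norm_zero] at this; norm_num at this
  have hqc := fun m => continuous_qker_left S a m β
  have hQtop : energy (s - 1) (fun n => ‖fc (fun α => qker S a (fun _ _ => 1) α β) n‖ₑ) ≠ ⊤ :=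
    ne_top_of_le_ne_top (ENNReal.mul_ne_top (by simp) hE) hQE
  have hinv := h₁ (fun α => qker S a (fun _ _ => 1) α β) (fun α => qker S a (fun n _ => I * n * 1) α β)
    (fun α => (qker S a (fun _ _ => 1) α β)⁻¹) (-1)
    (fun α => hasDerivAt_qker_left S a _ α β) (hqc _) (qker_periodic_left S a _ β)
    (fun α => hasDerivAt_inv_qker (hQ0 α β))
    (fun α => congrArg (·⁻¹) (qker_periodic_left S a (fun _ _ => 1) β α)) (by simp)
    (fun α => by
      rw [norm_inv]
      refine inv_le_of_inv_le₀ (by norm_num) ?_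
      have := hQ α β
      simpa using this) hQtop
  have hinvtop := (hinv.trans_lt (ENNReal.mul_lt_top ENNReal.coe_lt_top
    (ENNReal.pow_lt_top (ENNReal.add_lt_top.2 ⟨ENNReal.one_lt_top, hQtop.lt_top⟩)))).ne
  have := h₂ (s - 2) (s - 1) (by linarith) (by linarith) (by linarith) le_rfl
    (fun α => (qker S a (fun _ _ => 1) α β)⁻¹) (fun α => qker S a m α β)
    (((hqc _).inv₀ fun α => hQ0 α β).intervalIntegrable _ _) ((hqc m).intervalIntegrable _ _) hinvtop
  refine this.trans ?_
  calc _ ≤ C₂ * ((C₁ * (384 * 1 + 384 * E) ^ p) * (48 * (1 + E))) := by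
        gcongr
        · refine hinv.trans ?_
          gcongr
          norm_num
        · refine hmE.trans ?_
          gcongr
          exact le_add_self
    _ = _ := by rw [← mul_add, mul_pow]; push_cast; ring

/-- Minkowski's inequality for the weighted energies. -/
theorem energy_integral_le {ρ : ℝ} {μ : Measure ℝ} {x : ℝ → ℝ≥0∞} {y : ℝ → ℤ → ℝ≥0∞}
    {z : ℤ → ℝ≥0∞} {B : ℝ≥0∞} (hx : AEMeasurable x μ) (hy : ∀ n, AEMeasurable (fun β => y β n) μ)
    (hz : ∀ n, z n ≤ ∫⁻ β, x β * y β n ∂μ) (hB : ∀ β, energy ρ (y β) ≤ B) :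
    energy ρ z ≤ (∫⁻ β, x β ∂μ) ^ 2 * B := by
  calc energy ρ z ≤ ∑' n, (∫⁻ β, x β ∂μ) * ∫⁻ β, wt n ^ (2 * ρ) * (x β * y β n ^ 2) ∂μ := by
        refine ENNReal.tsum_le_tsum fun n => ?_
        calc _ ≤ wt n ^ (2 * ρ) * ((∫⁻ β, x β ∂μ) * ∫⁻ β, x β * y β n ^ 2 ∂μ) := by
              gcongr
              exact (pow_le_pow_left' (hz n) 2).trans (lintegral_mul_sq_le hx (hy n))
          _ = _ := by rw [lintegral_const_mul'' (f := fun β => x β * y β n ^ 2) _ (hx.mul ((hy n).pow_const _))]; ring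
    _ = (∫⁻ β, x β ∂μ) * ∫⁻ β, x β * energy ρ (y β) ∂μ := by
        rw [ENNReal.tsum_mul_left, ← lintegral_tsum]
        · congr 2; ext β
          rw [energy, ← ENNReal.tsum_mul_left]
          exact tsum_congr fun n => by ring
        · exact fun n => (hx.mul ((hy n).pow_const _)).const_mul _
    _ ≤ (∫⁻ β, x β ∂μ) * ∫⁻ β, x β * B ∂μ := by
        gcongr with β; exact hB β
    _ = _ := by rw [lintegral_mul_const'' _ hx]; ring

theorem continuous_fc_param {A : ℝ → ℝ → ℂ} (hA : Continuous (fun p : ℝ × ℝ => A p.1 p.2)) (n : ℤ) :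
    Continuous (fun β => fc (fun α => A α β) n) := by
  have := continuous_ek
  simp only [fc_eq]
  refine continuous_const.mul ?_
  refine intervalIntegral.continuous_parametric_intervalIntegral_of_continuous'
    (f := fun β α => ek (-n) α * A α β) ?_ 0 (2*π)
  exact ((continuous_ek (-n)).comp continuous_snd).mul (hA.comp continuous_swap)

theorem integral_mul_fc_eq {F : ℝ → ℂ} {A : ℝ → ℝ → ℂ}
    (h : Integrable (fun p : ℝ × ℝ => F p.1 * A p.2 p.1)
      ((volume.restrict (Set.Ioc 0 (2*π))).prod (volume.restrict (Set.Ioc 0 (2*π))))) (n : ℤ) :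
    ∫ β in (0:ℝ)..(2*π), F β * fc (fun α => A α β) n =
      fc (fun α => ∫ β in (0:ℝ)..(2*π), F β * A α β) n := by
  have h' : Integrable (fun p : ℝ × ℝ => ek (-n) p.2 * (F p.1 * A p.2 p.1))
      ((volume.restrict (Set.Ioc 0 (2*π))).prod (volume.restrict (Set.Ioc 0 (2*π)))) :=
    h.bdd_mul (c := 1) ((continuous_ek (-n)).comp continuous_snd).aestronglyMeasurable
      (Eventually.of_forall fun p => (norm_ek _ _).le)
  have hswap := integral_integral_swap
    (f := fun β α => ek (-n) α * (F β * A α β)) h'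
  simp only [fc_eq, intervalIntegral.integral_of_le Real.two_pi_pos.le, ← integral_const_mul]
  calc _ = (1 / (2 * (π : ℂ))) * ∫ β in Set.Ioc 0 (2*π), ∫ α in Set.Ioc 0 (2*π),
        ek (-n) α * (F β * A α β) := by
        simp only [← integral_const_mul]
        refine integral_congr_ae (Eventually.of_forall fun β =>
          integral_congr_ae (Eventually.of_forall fun α => ?_))
        ring
    _ = _ := by rw [hswap]; simp only [← integral_const_mul]

theorem integral_mul_fc_eq_of_continuous {F : ℝ → ℂ} {A : ℝ → ℝ → ℂ} (hF : Continuous F)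
    (hA : Continuous (fun p : ℝ × ℝ => A p.1 p.2)) (n : ℤ) :
    ∫ β in (0:ℝ)..(2*π), F β * fc (fun α => A α β) n =
      fc (fun α => ∫ β in (0:ℝ)..(2*π), F β * A α β) n := by
  refine integral_mul_fc_eq ?_ n
  rw [Measure.prod_restrict, ← Measure.volume_eq_prod]
  have : Continuous fun p : ℝ × ℝ => F p.1 * A p.2 p.1 :=
    (hF.comp continuous_fst).mul (hA.comp continuous_swap)
  exact (this.continuousOn.integrableOn_compact (isCompact_Icc.prod isCompact_Icc)).mono_set
    (Set.prod_mono Set.Ioc_subset_Icc_self Set.Ioc_subset_Icc_self)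

/-- Integrating by parts in both variables. -/
theorem integral_mul_fc_by_parts {F F' : ℝ → ℂ} {A B G : ℝ → ℝ → ℂ}
    (hF : ∀ x, HasDerivAt F (F' x) x) (hF' : Continuous F') (pF : Function.Periodic F (2*π))
    (hA : ∀ α β, HasDerivAt (fun α => A α β) (G α β) α)
    (pA : ∀ β, Function.Periodic (fun α => A α β) (2*π))
    (hB : ∀ α β, HasDerivAt (fun β => B α β) (G α β) β)
    (pB : ∀ α, Function.Periodic (fun β => B α β) (2*π))
    (hBc : Continuous (fun p : ℝ × ℝ => B p.1 p.2))
    (hG : Continuous (fun p : ℝ × ℝ => G p.1 p.2)) (n : ℤ) :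
    I * n * ∫ β in (0:ℝ)..(2*π), F β * fc (fun α => A α β) n =
      -∫ β in (0:ℝ)..(2*π), F' β * fc (fun α => B α β) n := by
  have hFc : Continuous F := continuous_iff_continuousAt.2 fun x => (hF x).continuousAt
  have hGl : ∀ β, Continuous fun α => G α β := fun β => hG.comp (Continuous.prodMk_left β)
  have hGr : ∀ α, Continuous fun β => G α β := fun α => hG.comp (Continuous.prodMk_right α)
  calc I * n * ∫ β in (0:ℝ)..(2*π), F β * fc (fun α => A α β) n
      = ∫ β in (0:ℝ)..(2*π), F β * fc (fun α => G α β) n := by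
        rw [← intervalIntegral.integral_const_mul]
        refine intervalIntegral.integral_congr fun β _ => ?_
        simp only [fc_deriv (fun α => hA α β) (hGl β) (pA β)]
        ring
    _ = fc (fun α => ∫ β in (0:ℝ)..(2*π), F β * G α β) n :=
        integral_mul_fc_eq_of_continuous hFc hG n
    _ = fc (fun α => -1 * ∫ β in (0:ℝ)..(2*π), F' β * B α β) n := by
        congr 1; ext α
        rw [intervalIntegral.integral_mul_deriv_eq_deriv_mul (fun x _ => hF x) (fun x _ => hB α x)
          (hF'.intervalIntegrable _ _) ((hGr α).intervalIntegrable _ _)]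
        have h1 := pF 0
        have h2 := pB α 0
        simp only [zero_add] at h1 h2
        rw [h1, h2]; ring
    _ = _ := by rw [fc_const_mul, integral_mul_fc_eq_of_continuous hF' hBc n]; ring

/-- The kernel `ω'(β) / (ω(α) - ω(β)) - cot((α - β) / 2) / 2` of a trigonometric polynomial. -/
def hker (S : Finset ℤ) (a : ℤ → ℂ) (α β : ℝ) : ℂ :=
  -(I / 2) - (qker S a (fun _ _ => 1) α β)⁻¹ * qker S a (fun _ l => I * l * 1) α β

theorem continuous_inv_qker_mul {S : Finset ℤ} {a : ℤ → ℂ}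
    (hQ : ∀ α β, qker S a (fun _ _ => 1) α β ≠ 0) (m : ℤ → ℤ → ℂ) :
    Continuous (fun p : ℝ × ℝ => (qker S a (fun _ _ => 1) p.1 p.2)⁻¹ * qker S a m p.1 p.2) :=
  ((continuous_qker S a _).inv₀ fun p => hQ p.1 p.2).mul (continuous_qker S a m)

theorem continuous_hker {S : Finset ℤ} {a : ℤ → ℂ}
    (hQ : ∀ α β, qker S a (fun _ _ => 1) α β ≠ 0) :
    Continuous (fun p : ℝ × ℝ => hker S a p.1 p.2) :=
  continuous_const.sub (continuous_inv_qker_mul hQ _)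

theorem fc_hker {S : Finset ℤ} {a : ℤ → ℂ} (hQ : ∀ α β, qker S a (fun _ _ => 1) α β ≠ 0)
    (β : ℝ) (n : ℤ) : fc (fun α => hker S a α β) n = (if n = 0 then -(I / 2) else 0) +
      -1 * fc (fun α => (qker S a (fun _ _ => 1) α β)⁻¹ * qker S a (fun _ l => I * l * 1) α β) n := by
  have h : (fun α => hker S a α β) = fun α => -(I / 2) * ek 0 α +
      -1 * ((qker S a (fun _ _ => 1) α β)⁻¹ * qker S a (fun _ l => I * l * 1) α β) := by
    ext α; rw [hker, ek_zero]; ring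
  have hc : Continuous fun α =>
      (qker S a (fun _ _ => 1) α β)⁻¹ * qker S a (fun _ l => I * l * 1) α β :=
    ((continuous_qker_left S a _ β).inv₀ fun α => hQ α β).mul (continuous_qker_left S a _ β)
  rw [h, fc_add (((continuous_ek 0).const_mul _).intervalIntegrable _ _)
    ((hc.const_mul _).intervalIntegrable _ _), fc_const_mul, fc_const_mul, fc_ek]
  split_ifs <;> simp

theorem enorm_integral_mul_fc_le (F : ℝ → ℂ) (A : ℝ → ℝ → ℂ) (n : ℤ) :
    ‖∫ β in (0:ℝ)..(2*π), F β * fc (fun α => A α β) n‖ₑ ≤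
      ∫⁻ β in Set.Ioc 0 (2*π), ‖F β‖ₑ * ‖fc (fun α => A α β) n‖ₑ := by
  rw [intervalIntegral.integral_of_le Real.two_pi_pos.le]
  refine (enorm_integral_le_lintegral_enorm _).trans_eq ?_
  simp only [enorm_mul]

theorem energy_integral_mul_fc_le {ρ : ℝ} {F : ℝ → ℂ} {A : ℝ → ℝ → ℂ} {B : ℝ≥0∞}
    (hF : IntervalIntegrable F volume 0 (2*π)) (hA : Continuous (fun p : ℝ × ℝ => A p.1 p.2))
    (hB : ∀ β, energy ρ (fun n => ‖fc (fun α => A α β) n‖ₑ) ≤ B) :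
    energy ρ (fun n => ‖∫ β in (0:ℝ)..(2*π), F β * fc (fun α => A α β) n‖ₑ) ≤
      (∫⁻ β in Set.Ioc 0 (2*π), ‖F β‖ₑ) ^ 2 * B :=
  energy_integral_le
    (((intervalIntegrable_iff_integrableOn_Ioc_of_le Real.two_pi_pos.le).1 hF).aemeasurable.enorm)
    (fun n => (continuous_fc_param hA n).measurable.enorm.aemeasurable)
    (enorm_integral_mul_fc_le F A) hB

theorem hasDerivAt_inv_qker_mul_left {S : Finset ℤ} {a : ℤ → ℂ}
    (hQ : ∀ α β, qker S a (fun _ _ => 1) α β ≠ 0) (α β : ℝ) :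
    HasDerivAt (fun α => (qker S a (fun _ _ => 1) α β)⁻¹ * qker S a (fun _ l => I * l * 1) α β)
      ((qker S a (fun _ _ => 1) α β)⁻¹ * qker S a (fun n l => I * n * (I * l * 1)) α β -
        ((qker S a (fun _ _ => 1) α β)⁻¹ * qker S a (fun n _ => I * n * 1) α β) *
        ((qker S a (fun _ _ => 1) α β)⁻¹ * qker S a (fun _ l => I * l * 1) α β)) α := by
  refine (((hasDerivAt_qker_left S a (fun _ _ => 1) α β).inv (hQ α β)).mul
    (hasDerivAt_qker_left S a (fun _ l => I * l * 1) α β)).congr_deriv ?_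
  have := hQ α β
  simp only [Pi.inv_apply]
  field_simp
  ring

theorem hasDerivAt_inv_qker_mul_right {S : Finset ℤ} {a : ℤ → ℂ}
    (hQ : ∀ α β, qker S a (fun _ _ => 1) α β ≠ 0) (α β : ℝ) :
    HasDerivAt (fun β => (qker S a (fun _ _ => 1) α β)⁻¹ * qker S a (fun n _ => I * n * 1) α β)
      ((qker S a (fun _ _ => 1) α β)⁻¹ * qker S a (fun n l => I * n * (I * l * 1)) α β -
        ((qker S a (fun _ _ => 1) α β)⁻¹ * qker S a (fun n _ => I * n * 1) α β) *
        ((qker S a (fun _ _ => 1) α β)⁻¹ * qker S a (fun _ l => I * l * 1) α β)) β := by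
  refine (((hasDerivAt_qker_right S a (fun _ _ => 1) α β).inv (hQ α β)).mul
    (hasDerivAt_qker_right S a (fun n _ => I * n * 1) α β)).congr_deriv ?_
  have := hQ α β
  have e : (fun n l : ℤ => I * l * (I * n * 1)) = fun n l : ℤ => I * n * (I * l * 1) := by
    ext n l; ring
  rw [e]
  simp only [Pi.inv_apply]
  field_simp
  ring

theorem fc_hker_by_parts {S : Finset ℤ} {a : ℤ → ℂ} {F F' : ℝ → ℂ}
    (hQ : ∀ α β, qker S a (fun _ _ => 1) α β ≠ 0)
    (hF : ∀ x, HasDerivAt F (F' x) x) (hF' : Continuous F') (pF : Function.Periodic F (2*π)) (n : ℤ) :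
    I * n * ∫ β in (0:ℝ)..(2*π), F β * fc (fun α => hker S a α β) n =
      ∫ β in (0:ℝ)..(2*π), F' β * fc (fun α =>
        (qker S a (fun _ _ => 1) α β)⁻¹ * qker S a (fun n _ => I * n * 1) α β) n := by
  have h := integral_mul_fc_by_parts hF hF' pF
    (A := fun α β => (qker S a (fun _ _ => 1) α β)⁻¹ * qker S a (fun _ l => I * l * 1) α β)
    (B := fun α β => (qker S a (fun _ _ => 1) α β)⁻¹ * qker S a (fun n _ => I * n * 1) α β)
    (hasDerivAt_inv_qker_mul_left hQ)
    (fun β α => congrArg₂ (· * ·) (congrArg (·⁻¹) (qker_periodic_left S a (fun _ _ => 1) β α))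
      (qker_periodic_left S a _ β α))
    (hasDerivAt_inv_qker_mul_right hQ)
    (fun α β => congrArg₂ (· * ·) (congrArg (·⁻¹) (qker_periodic_right S a (fun _ _ => 1) α β))
      (qker_periodic_right S a _ α β))
    (continuous_inv_qker_mul hQ _)
    ((continuous_inv_qker_mul hQ _).sub
      ((continuous_inv_qker_mul hQ _).mul (continuous_inv_qker_mul hQ _))) n
  rw [← neg_eq_iff_eq_neg] at h
  rw [← h, ← intervalIntegral.integral_const_mul, ← intervalIntegral.integral_const_mul,
    ← intervalIntegral.integral_neg]
  refine intervalIntegral.integral_congr fun β _ => ?_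
  simp only [fc_hker hQ]
  split_ifs with h0
  · simp [h0]
  · ring


theorem energy_hker_le {s : ℝ} (hs : 2 ≤ s) : ∃ (C : ℝ≥0) (p : ℕ),
    ∀ (S : Finset ℤ) (a b : ℤ → ℂ), (∀ k, ‖a k‖ₑ ≤ ‖b k‖ₑ) →
      (∀ k, (k.natAbs : ℝ≥0∞) * ‖a k‖ₑ ≤ ‖b k‖ₑ) →
      energy (s - 1) (fun n => ‖b n‖ₑ) ≠ ⊤ →
      (∀ α β, 1 / 16 ≤ ‖qker S a (fun _ _ => 1) α β‖) →
      ∀ F : ℝ → ℂ, IntervalIntegrable F volume 0 (2*π) →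
      energy (s - 2) (fun n => ‖∫ β in (0:ℝ)..(2*π), F β * fc (fun α => hker S a α β) n‖ₑ) ≤
        (∫⁻ β in Set.Ioc 0 (2*π), ‖F β‖ₑ) ^ 2 *
          (C * (1 + energy (s - 1) (fun n => ‖b n‖ₑ)) ^ p) ∧
      ∀ F' : ℝ → ℂ, (∀ x, HasDerivAt F (F' x) x) → Continuous F' → Function.Periodic F (2*π) →
        energy (s - 1) (fun n => ‖∫ β in (0:ℝ)..(2*π), F β * fc (fun α => hker S a α β) n‖ₑ) ≤
        4 * ((∫⁻ β in Set.Ioc 0 (2*π), ‖F β‖ₑ) ^ 2 + (∫⁻ β in Set.Ioc 0 (2*π), ‖F' β‖ₑ) ^ 2) *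
          (C * (1 + energy (s - 1) (fun n => ‖b n‖ₑ)) ^ p) := by
  obtain ⟨C, p, h⟩ := energy_kernel_le hs
  refine ⟨2 * (1 + C), p, fun S a b ha0 ha hE hQ F hF => ?_⟩
  set E := energy (s - 1) (fun n => ‖b n‖ₑ)
  have hQ0 : ∀ α β, qker S a (fun _ _ => 1) α β ≠ 0 := fun α β h => by
    have := hQ α β
    rw [h, norm_zero] at this; norm_num at this
  have h1E : (1 : ℝ≥0∞) ≤ (1 + E) ^ p := one_le_pow₀ le_self_add
  have hA : ∀ β, energy (s - 2) (fun n => ‖fc (fun α => hker S a α β) n‖ₑ) ≤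
      ((2 * (1 + C) : ℝ≥0) : ℝ≥0∞) * (1 + E) ^ p := fun β => by
    refine (energy_mono (y := fun n => ‖(if n = 0 then -(I / 2) else 0 : ℂ)‖ₑ +
      ‖fc (fun α => (qker S a (fun _ _ => 1) α β)⁻¹ *
        qker S a (fun _ l => I * l * 1) α β) n‖ₑ) fun n => ?_).trans
      ((energy_add _ _ _).trans ?_)
    · rw [fc_hker hQ0]
      refine (enorm_add_le _ _).trans_eq ?_
      rw [neg_one_mul, enorm_neg]
    · have e1 : energy (s - 2) (fun n : ℤ => ‖(if n = 0 then -(I / 2) else 0 : ℂ)‖ₑ) ≤ 1 := by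
        rw [energy, tsum_eq_single 0 (fun n hn => by simp [hn])]
        have : ‖(-(I / 2) : ℂ)‖ₑ ≤ 1 := by
          rw [← ofReal_norm]
          refine ENNReal.ofReal_le_one.2 ?_
          simp; norm_num
        simp only [if_true]
        calc _ ≤ wt 0 ^ (2 * (s - 2)) * 1 ^ 2 := by gcongr
          _ = 1 := by simp [wt]
      have e2 := h S a b (fun _ l => I * l * 1) ha0 ha hE hQ (fun k n hn => by
        rw [mul_one, enorm_mul, enorm_I, one_mul, enorm_intCast]
        exact_mod_cast (natAbs_le_of_mem_modes hn).2) β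
      calc _ ≤ 2 * (1 * (1 + E) ^ p + C * (1 + E) ^ p) := by
            rw [one_mul]
            gcongr
            exact e1.trans h1E
        _ = _ := by push_cast; ring
  have hB : ∀ β, energy (s - 2) (fun n => ‖fc (fun α => (qker S a (fun _ _ => 1) α β)⁻¹ *
      qker S a (fun n _ => I * n * 1) α β) n‖ₑ) ≤
      ((2 * (1 + C) : ℝ≥0) : ℝ≥0∞) * (1 + E) ^ p := fun β => by
    refine (h S a b (fun n _ => I * n * 1) ha0 ha hE hQ (fun k n hn => by
        rw [mul_one, enorm_mul, enorm_I, one_mul, enorm_intCast]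
        exact_mod_cast (natAbs_le_of_mem_modes hn).1) β).trans ?_
    gcongr
    have : C ≤ 2 * (1 + C) := by
      rw [← NNReal.coe_le_coe]; push_cast; linarith [C.2]
    exact this
  have h0 := energy_integral_mul_fc_le hF (continuous_hker hQ0) hA
  refine ⟨h0, fun F' hF hF' pF => ?_⟩
  have h2 := energy_integral_mul_fc_le (hF'.intervalIntegrable _ _)
    (continuous_inv_qker_mul hQ0 (fun n _ => I * n * 1)) hB
  have h3 := energy_add_one_le (s - 2) (fun n => ‖∫ β in (0:ℝ)..(2*π),
    F β * fc (fun α => hker S a α β) n‖ₑ)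
  rw [show s - 2 + 1 = s - 1 by ring] at h3
  refine h3.trans ?_
  rw [mul_assoc, add_mul]
  gcongr
  · exact (energy_mono_exp (by linarith) _).trans h0
  · refine (energy_mono fun n => ?_).trans h2
    rw [← fc_hker_by_parts hQ0 hF hF' pF n, enorm_mul, enorm_mul, enorm_I, one_mul, enorm_intCast]

theorem ofReal_rpow_mul_le {s : ℝ} (hs : 0 ≤ s) (u : ℝ → ℂ) (k : ℤ) :
    ENNReal.ofReal (|(k:ℝ)| ^ (2*s) * ‖fc u k‖^2) ≤ wt k ^ (2*s) * ‖fc u k‖ₑ ^ 2 := by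
  rw [ENNReal.ofReal_mul (by positivity), wt_rpow_eq_ofReal, ← ofReal_norm,
    ← ENNReal.ofReal_pow (norm_nonneg _)]
  gcongr
  rw [Nat.cast_natAbs, Int.cast_abs]
  linarith

theorem summable_and_hnormSq_le {s : ℝ} (hs : 0 ≤ s) {u : ℝ → ℂ}
    (h : energy s (fun n => ‖fc u n‖ₑ) ≠ ⊤) :
    Summable (fun k : ℤ => |(k:ℝ)| ^ (2*s) * ‖fc u k‖^2) ∧
      hnormSq s u ≤ 2 * (energy s (fun n => ‖fc u n‖ₑ)).toReal := by
  have h1 : ∑' k : ℤ, ENNReal.ofReal (|(k:ℝ)| ^ (2*s) * ‖fc u k‖^2) ≤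
      energy s (fun n => ‖fc u n‖ₑ) := ENNReal.tsum_le_tsum (ofReal_rpow_mul_le hs u)
  have hsum : Summable (fun k : ℤ => |(k:ℝ)| ^ (2*s) * ‖fc u k‖^2) := by
    have := ENNReal.summable_toReal (ne_top_of_le_ne_top h h1)
    refine this.congr fun k => ENNReal.toReal_ofReal (by positivity)
  refine ⟨hsum, ?_⟩
  rw [← ENNReal.ofReal_tsum_of_nonneg (fun k => by positivity) hsum] at h1
  have h2 := (ENNReal.ofReal_le_iff_le_toReal h).1 h1
  have h3 : ‖fc u 0‖ ^ 2 ≤ (energy s (fun n => ‖fc u n‖ₑ)).toReal := by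
    refine (ENNReal.ofReal_le_iff_le_toReal h).1 ?_
    refine le_trans ?_ (ENNReal.le_tsum 0)
    simp [wt, ENNReal.ofReal_pow]
  rw [hnormSq]; linarith

theorem energy_le_hnormSq {s : ℝ} (hs : 0 ≤ s) {u : ℝ → ℂ}
    (h : Summable (fun k : ℤ => |(k:ℝ)| ^ (2*s) * ‖fc u k‖^2)) :
    energy s (fun n => ‖fc u n‖ₑ) ≤ ENNReal.ofReal (4 ^ s * hnormSq s u) := by
  have hle : ∀ k : ℤ, (1 + (k.natAbs:ℝ)) ^ (2*s) * ‖fc u k‖ ^ 2 ≤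
      4 ^ s * (|(k:ℝ)| ^ (2*s) * ‖fc u k‖^2 + if k = 0 then ‖fc u 0‖ ^ 2 else 0) := fun k => by
    have h4 : (1:ℝ) ≤ 4 ^ s := Real.one_le_rpow (by norm_num) hs
    rcases eq_or_ne k 0 with rfl | hk
    · simp only [Int.natAbs_zero, Nat.cast_zero, add_zero, Real.one_rpow, one_mul, if_true]
      have : (0:ℝ) ≤ |((0:ℤ):ℝ)| ^ (2*s) * ‖fc u 0‖^2 := by positivity
      nlinarith [sq_nonneg ‖fc u 0‖]
    · have hk1 : (1:ℝ) ≤ |(k:ℝ)| := by exact_mod_cast Int.one_le_abs hk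
      have e : (4:ℝ) ^ s = 2 ^ (2*s) := by rw [Real.rpow_mul (by norm_num)]; norm_num
      rw [if_neg hk, add_zero, ← mul_assoc, e, ← Real.mul_rpow (by norm_num) (abs_nonneg _),
        Nat.cast_natAbs, Int.cast_abs]
      gcongr
      linarith
  have hs2 : HasSum (fun k : ℤ => |(k:ℝ)| ^ (2*s) * ‖fc u k‖^2 + if k = 0 then ‖fc u 0‖ ^ 2 else 0)
      (hnormSq s u) := h.hasSum.add (hasSum_ite_eq 0 _)
  rw [← (hs2.mul_left (4 ^ s)).tsum_eq, ENNReal.ofReal_tsum_of_nonneg ?_ (hs2.mul_left _).summable]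
  · refine ENNReal.tsum_le_tsum fun k => ?_
    beta_reduce
    rw [wt_rpow_eq_ofReal, ← ofReal_norm, ← ENNReal.ofReal_pow (norm_nonneg _),
      ← ENNReal.ofReal_mul (by positivity)]
    exact ENNReal.ofReal_le_ofReal (hle k)
  · intro k
    have := hle k
    exact le_trans (by positivity) this

theorem hasDerivAt_wser {c : ℤ → ℂ} (hc : Summable fun k => ‖c k‖)
    (hc' : Summable fun k => ‖I * k * c k‖) (α : ℝ) :
    HasDerivAt (wser c) (wser (fun k => I * k * c k) α) α := by
  have := hasDerivAt_tsum (u := fun k => ‖I * k * c k‖) (g := fun k α => c k * ek k α)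
    (g' := fun k α => I * k * c k * ek k α) (y₀ := 0) hc'
    (fun k y => ((hasDerivAt_ek k y).const_mul (c k)).congr_deriv (by ring))
    (fun k y => (norm_mul_ek _ _ _).le) (hasSum_wser hc 0).summable α
  exact this

theorem ae_of_ae_Ioc_of_periodic {u v : ℝ → ℂ} (hu : Function.Periodic u (2*π))
    (hv : Function.Periodic v (2*π)) (h : ∀ᵐ x, x ∈ Set.Ioc 0 (2*π) → u x = v x) :
    ∀ᵐ x, u x = v x := by
  have h1 : ∀ᵐ x, ∀ n : ℤ, x - n • (2*π) ∈ Set.Ioc 0 (2*π) →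
      u (x - n • (2*π)) = v (x - n • (2*π)) := ae_all_iff.2 fun n =>
    (measurePreserving_sub_right volume (n • (2*π))).quasiMeasurePreserving.ae h
  filter_upwards [h1] with x hx
  obtain ⟨n, hn, -⟩ := existsUnique_sub_zsmul_mem_Ioc Real.two_pi_pos x 0
  rw [zero_add] at hn
  have := hx n hn
  rwa [hu.sub_zsmul_eq, hv.sub_zsmul_eq] at this

theorem summable_norm_mul_of_energy {c : ℤ → ℂ} {ρ : ℝ} (hρ : 2 ≤ ρ)
    (h : energy ρ (fun n => ‖c n‖ₑ) ≠ ⊤) : Summable fun k : ℤ => ‖I * k * c k‖ := by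
  refine summable_norm_of_energy (ρ := ρ - 1) (by linarith) ?_
  refine ne_top_of_le_ne_top h ?_
  have := energy_natAbs_le (ρ - 1) (fun n => ‖c n‖ₑ)
  rw [sub_add_cancel] at this
  refine le_trans (energy_mono fun n => ?_) this
  rw [enorm_mul, enorm_mul, enorm_I, one_mul, enorm_intCast]

theorem exp_I_eq_ek_one (α : ℝ) : exp (I * (α:ℂ)) = ek 1 α := by simp [ek]

theorem exp_neg_I_eq_ek_neg_one (α : ℝ) : exp (-I * (α:ℂ)) = ek (-1) α := by simp [ek]

theorem energy_ek_ne_top (ρ : ℝ) (k : ℤ) : energy ρ (fun n => ‖fc (ek k) n‖ₑ) ≠ ⊤ := by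
  rw [energy, tsum_eq_single k (fun n hn => by simp [fc_ek, hn]), wt_rpow_eq_ofReal]
  simp [fc_ek]

theorem energy_const_mul_ek_ne_top (ρ : ℝ) (c : ℂ) (k : ℤ) :
    energy ρ (fun n => ‖fc (fun α => c * ek k α) n‖ₑ) ≠ ⊤ := by
  simp only [fc_const_mul, enorm_mul, energy_const_mul]
  exact ENNReal.mul_ne_top (by simp) (energy_ek_ne_top ρ k)

theorem energy_fc_add_ne_top {ρ : ℝ} {u v : ℝ → ℂ} (hu : IntervalIntegrable u volume 0 (2*π))
    (hv : IntervalIntegrable v volume 0 (2*π)) (h : energy ρ (fun n => ‖fc u n‖ₑ) ≠ ⊤)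
    (h' : energy ρ (fun n => ‖fc v n‖ₑ) ≠ ⊤) :
    energy ρ (fun n => ‖fc (fun α => u α + v α) n‖ₑ) ≠ ⊤ := by
  simp only [fc_add hu hv]
  refine ne_top_of_le_ne_top (ENNReal.mul_ne_top (by simp) (ENNReal.add_ne_top.2 ⟨h, h'⟩))
    ((energy_mono fun n => enorm_add_le _ _).trans (energy_add ρ _ _))

/-- The regular representative of the tangent of the curve `ω`. -/
theorem exists_tangent {s : ℝ} (hs : 2 ≤ s) {θt : ℝ → ℂ} (c : ℂ) (hθ : MemHdot s θt) :
    ∃ g : ℝ → ℂ, Continuous g ∧ Function.Periodic g (2*π) ∧ (∀ α, ‖g α‖ = 1) ∧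
      energy s (fun n => ‖fc g n‖ₑ) ≠ ⊤ ∧
      ∀ᵐ τ : ℝ, exp (I * (τ:ℂ) + I * c * exp (I * (τ:ℂ))
        + I * (starRingEnd ℂ c) * exp (-I * (τ:ℂ)) + I * θt τ) = g τ := by
  obtain ⟨⟨pθ, iθ, sθ⟩, rθ, -, -, -⟩ := hθ
  have hE : energy s (fun n => ‖fc θt n‖ₑ) ≠ ⊤ :=
    ne_top_of_le_ne_top ENNReal.ofReal_ne_top (energy_le_hnormSq (by linarith) sθ)
  have hsum : Summable fun k => ‖fc θt k‖ := summable_norm_of_energy (by linarith) hE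
  have hsum' := summable_norm_mul_of_energy hs hE
  have hw := continuous_wser hsum
  have hae : ∀ᵐ x, θt x = wser (fc θt) x :=
    ae_of_ae_Ioc_of_periodic pθ (wser_periodic _) (ae_eq_wser iθ hsum)
  have hre : ∀ x, (wser (fc θt) x).im = 0 := by
    have h1 : (fun x => (wser (fc θt) x).im) =ᵐ[volume] fun _ => (0:ℝ) := by
      filter_upwards [hae] with x hx
      rw [← hx, rθ x]
    have := Continuous.ae_eq_iff_eq volume (continuous_im.comp hw) continuous_const |>.1 h1
    exact congrFun this
  set φ : ℝ → ℂ := fun α => wser (fc θt) α + (c * ek 1 α + (starRingEnd ℂ c) * ek (-1) α) with hφ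
  have hek := continuous_ek
  have hφc : Continuous φ := by fun_prop
  have hφre : ∀ x, (φ x).im = 0 := fun x => by
    rw [hφ]
    simp only [add_im, hre, ek_neg, ← map_mul, conj_im]; ring
  have hφE : energy s (fun n => ‖fc φ n‖ₑ) ≠ ⊤ := by
    refine energy_fc_add_ne_top (hw.intervalIntegrable _ _)
      (Continuous.intervalIntegrable (by fun_prop) _ _) ?_ ?_
    · simpa only [fc_wser hsum] using hE
    · exact energy_fc_add_ne_top (Continuous.intervalIntegrable (by fun_prop) _ _)
        (Continuous.intervalIntegrable (by fun_prop) _ _) (energy_const_mul_ek_ne_top _ _ _)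
        (energy_const_mul_ek_ne_top _ _ _)
  have hφp : Function.Periodic φ (2*π) := fun x => by
    simp only [hφ, wser_periodic (fc θt) x, ek_periodic _ x]
  set φ' : ℝ → ℂ := fun α => wser (fun k => I * k * fc θt k) α +
    (c * (I * (1:ℤ) * ek 1 α) + (starRingEnd ℂ c) * (I * (-1:ℤ) * ek (-1) α)) with hφ'
  have hd : ∀ x, HasDerivAt φ (φ' x) x := fun x =>
    (hasDerivAt_wser hsum hsum' x).add
      (((hasDerivAt_ek 1 x).const_mul _).add ((hasDerivAt_ek (-1) x).const_mul _))
  have hφ'c : Continuous φ' := by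
    have := continuous_wser hsum'
    fun_prop
  obtain ⟨C, p, h⟩ := energy_bootstrap (R := s) (by linarith) 1 1
  have hnv : ∀ x, ‖exp (I * φ x)‖ = 1 := fun x => by
    rw [norm_exp]; simp [hφre x]
  have hv := h φ φ' (fun x => exp (I * φ x)) I hd hφ'c hφp
    (fun x => ((hd x).const_mul I).cexp.congr_deriv (by ring))
    (fun x => by simp only [hφp x]) (by simp) (fun x => by simp [hnv x]) hφE
  have hvtop : energy s (fun n => ‖fc (fun x => exp (I * φ x)) n‖ₑ) ≠ ⊤ :=
    ne_top_of_le_ne_top (ENNReal.mul_ne_top (by simp)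
      (ENNReal.pow_ne_top (ENNReal.add_ne_top.2 ⟨by simp, hφE⟩))) hv
  have hvc : Continuous fun x => exp (I * φ x) := by fun_prop
  obtain ⟨C₂, h₂⟩ := energy_fc_mul s
  refine ⟨fun x => ek 1 x * exp (I * φ x), by fun_prop, fun x => ?_, fun x => ?_, ?_, ?_⟩
  · simp only [hφp x, ek_periodic 1 x]
  · rw [norm_mul, norm_ek, hnv, one_mul]
  · refine ne_top_of_le_ne_top ?_ (h₂ s s (by linarith) le_rfl (by linarith) le_rfl _ _
      ((continuous_ek 1).intervalIntegrable _ _) (hvc.intervalIntegrable _ _)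
      (energy_ek_ne_top _ _))
    exact ENNReal.mul_ne_top (by simp) (ENNReal.mul_ne_top (energy_ek_ne_top _ _) hvtop)
  · filter_upwards [hae] with τ hτ
    rw [← exp_I_eq_ek_one, ← exp_add, hφ, hτ]
    congr 1
    simp only [exp_I_eq_ek_one, exp_neg_I_eq_ek_neg_one]
    ring

theorem hasDerivAt_omegaCurve {θt g : ℝ → ℂ} {c : ℂ} (hg : Continuous g)
    (h : ∀ᵐ τ : ℝ, exp (I * (τ:ℂ) + I * c * exp (I * (τ:ℂ))
        + I * (starRingEnd ℂ c) * exp (-I * (τ:ℂ)) + I * θt τ) = g τ) (α : ℝ) :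
    HasDerivAt (omegaCurve θt c) (g α) α := by
  have e : omegaCurve θt c = fun α => ∫ τ in (0:ℝ)..α, g τ := by
    ext α
    exact intervalIntegral.integral_congr_ae (h.mono fun x hx _ => hx)
  rw [e]
  exact intervalIntegral.integral_hasDerivAt_right (hg.intervalIntegrable _ _)
    (hg.stronglyMeasurableAtFilter _ _) hg.continuousAt

theorem fc_zero_of_constraint {θt g : ℝ → ℂ} {c : ℂ} (hc : ConstraintB4 θt c)
    (h : ∀ᵐ τ : ℝ, exp (I * (τ:ℂ) + I * c * exp (I * (τ:ℂ))
        + I * (starRingEnd ℂ c) * exp (-I * (τ:ℂ)) + I * θt τ) = g τ) : fc g 0 = 0 := by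
  rw [fc_eq]
  have : ∫ α in (0:ℝ)..(2*π), ek (-0) α * g α = 0 := by
    rw [← hc]
    refine intervalIntegral.integral_congr_ae (h.mono fun x hx _ => ?_)
    rw [← hx, neg_zero, ek_zero, one_mul]
    congr 1; ring
  rw [this, mul_zero]

theorem sub_mul_q1 {ω g : ℝ → ℂ} (hω : ∀ x, HasDerivAt ω (g x) x) (hg : Continuous g) (α β : ℝ) :
    ((α - β : ℝ) : ℂ) * q1 ω α β = ω α - ω β := by
  have hd : deriv ω = g := funext fun x => (hω x).deriv
  have h1 : ∀ t : ℝ, HasDerivAt (fun t : ℝ => ω (t*α + (1-t)*β))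
      (((α - β : ℝ) : ℂ) * g (t*α + (1-t)*β)) t := fun t => by
    have h2 : HasDerivAt (fun t : ℝ => t*α + (1-t)*β) (α - β) t := by
      refine (((hasDerivAt_id t).mul_const α).add
        (((hasDerivAt_id t).const_sub 1).mul_const β)).congr_deriv ?_
      ring
    refine ((hω _).scomp t h2).congr_deriv ?_
    rw [Complex.real_smul]
  have h3 := intervalIntegral.integral_eq_sub_of_hasDerivAt (a := 0) (b := 1) (fun t _ => h1 t)
    (Continuous.intervalIntegrable (by fun_prop) _ _)
  rw [q1, hd, ← intervalIntegral.integral_const_mul, h3]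
  simp

theorem norm_ek_one_sub_le (α β : ℝ) : ‖ek 1 α - ek 1 β‖ ≤ |α - β| := by
  have h : ek 1 α = ek 1 (α - β) * ek 1 β := by
    rw [ek, ek, ek, ← exp_add]; congr 1; push_cast; ring
  rw [h, ← sub_one_mul, norm_mul, norm_ek, mul_one, ← exp_I_eq_ek_one]
  exact Real.norm_exp_I_mul_ofReal_sub_one_le

theorem arc_chord {ω g : ℝ → ℂ} (hω : ∀ x, HasDerivAt ω (g x) x) (hg : Continuous g)
    (pω : Function.Periodic ω (2*π))
    (h : ∀ α β : ℝ, 0 < |α - β| → |α - β| ≤ π → (1/8 : ℝ) ≤ ‖q1 ω α β‖) (α β : ℝ) :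
    1 / 8 * ‖ek 1 α - ek 1 β‖ ≤ ‖ω α - ω β‖ := by
  set n : ℤ := round ((α - β) / (2*π))
  have hn : |(α - n * (2*π)) - β| ≤ π := by
    have h1 := abs_sub_round ((α - β) / (2*π))
    have h2 : (α - n * (2*π)) - β = ((α - β) / (2*π) - n) * (2*π) := by
      field_simp [Real.pi_ne_zero]
      ring
    rw [h2, abs_mul, abs_of_pos Real.two_pi_pos]
    nlinarith [Real.pi_pos]
  have e1 : ω α = ω (α - n * (2*π)) := (pω.sub_int_mul_eq n).symm
  have e2 : ek 1 α = ek 1 (α - n * (2*π)) :=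
    ((show Function.Periodic (ek 1) (2*π) from ek_periodic 1).sub_int_mul_eq n).symm
  rw [e1, e2]
  set α' := α - n * (2*π)
  have h3 := sub_mul_q1 hω hg α' β
  have h4 := norm_ek_one_sub_le α' β
  rcases (abs_nonneg (α' - β)).eq_or_lt with h0 | h0
  · rw [← h0] at h4
    rw [le_antisymm h4 (norm_nonneg _)]; simp
  · have h5 := h α' β h0 hn
    rw [← h3, norm_mul, Complex.norm_real, Real.norm_eq_abs]
    nlinarith [norm_nonneg (ek 1 α' - ek 1 β)]

/-- The Fourier coefficients of a primitive. -/
def prim (b : ℤ → ℂ) (k : ℤ) : ℂ := b k / (I * k)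

theorem I_mul_prim {b : ℤ → ℂ} (h : b 0 = 0) (k : ℤ) : I * k * prim b k = b k := by
  rcases eq_or_ne k 0 with rfl | hk
  · simp [h]
  · have : (k:ℂ) ≠ 0 := by exact_mod_cast hk
    rw [prim]; field_simp

theorem natAbs_mul_enorm_prim_le {b : ℤ → ℂ} (h : b 0 = 0) (k : ℤ) :
    (k.natAbs : ℝ≥0∞) * ‖prim b k‖ₑ ≤ ‖b k‖ₑ := by
  conv_rhs => rw [← I_mul_prim h k, enorm_mul, enorm_mul, enorm_I, one_mul, enorm_intCast]

theorem enorm_prim_le {b : ℤ → ℂ} (h : b 0 = 0) (k : ℤ) : ‖prim b k‖ₑ ≤ ‖b k‖ₑ := by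
  rcases eq_or_ne k 0 with rfl | hk
  · simp [prim]
  · refine le_trans ?_ (natAbs_mul_enorm_prim_le h k)
    have : (1:ℝ≥0∞) ≤ k.natAbs := by
      exact_mod_cast Nat.one_le_iff_ne_zero.2 (Int.natAbs_ne_zero.2 hk)
    calc _ = 1 * ‖prim b k‖ₑ := (one_mul _).symm
      _ ≤ _ := by gcongr

theorem norm_prim_le {b : ℤ → ℂ} (h : b 0 = 0) (k : ℤ) : ‖prim b k‖ ≤ ‖b k‖ := by
  have := enorm_prim_le h k
  rwa [enorm_le_iff_norm_le] at this

theorem sub_eq_wser_prim {ω g : ℝ → ℂ} (hω : ∀ x, HasDerivAt ω (g x) x) (hg : Continuous g)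
    (pg : Function.Periodic g (2*π)) (h0 : fc g 0 = 0) (hb : Summable fun k => ‖fc g k‖) (α β : ℝ) :
    ω α - ω β = wser (prim (fc g)) α - wser (prim (fc g)) β := by
  have ha : Summable fun k => ‖prim (fc g) k‖ :=
    Summable.of_nonneg_of_le (fun _ => norm_nonneg _) (norm_prim_le h0) hb
  have hd : ∀ x, HasDerivAt (wser (prim (fc g))) (g x) x := fun x => by
    have := hasDerivAt_wser ha (by simpa only [I_mul_prim h0] using hb) x
    simp only [I_mul_prim h0] at this
    rwa [show wser (fun k => fc g k) = g from (eq_wser hg pg hb).symm] at this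
  have := is_const_of_deriv_eq_zero (f := fun x => ω x - wser (prim (fc g)) x)
    (fun x => ((hω x).sub (hd x)).differentiableAt)
    (fun x => by
      refine ((hω x).sub (hd x)).deriv.trans ?_
      rw [sub_self]) α β
  linear_combination this

theorem periodic_of_sub_eq_wser {ω : ℝ → ℂ} {a : ℤ → ℂ}
    (h : ∀ α β, ω α - ω β = wser a α - wser a β) : Function.Periodic ω (2*π) := fun x => by
  have := h (x + 2*π) x
  rwa [wser_periodic a x, sub_self, sub_eq_zero] at this

theorem countable_ek_one_eq (β : ℝ) : {α : ℝ | ek 1 α = ek 1 β}.Countable := by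
  refine (Set.countable_range fun n : ℤ => β + n * (2*π)).mono fun α hα => ?_
  rw [Set.mem_ofPred_eq, ← exp_I_eq_ek_one, ← exp_I_eq_ek_one, exp_eq_exp_iff_exists_int] at hα
  obtain ⟨n, hn⟩ := hα
  refine ⟨n, ?_⟩
  have h : (α:ℂ) = ((β + n * (2*π) : ℝ) : ℂ) := by
    have : I * ((α:ℂ) - ((β + n * (2*π) : ℝ) : ℂ)) = 0 := by push_cast; linear_combination hn
    simpa [sub_eq_zero] using this
  exact (ofReal_injective h).symm

theorem ae_ek_one_ne (β : ℝ) : ∀ᵐ α : ℝ, ek 1 β ≠ ek 1 α := by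
  have := (countable_ek_one_eq β).measure_zero volume
  rw [ae_iff]
  simpa [eq_comm] using this

/-- The divided difference of `∑_k a_k e^{ikα}` with respect to `e^{iα}`. -/
def qlim (a : ℤ → ℂ) (m : ℤ → ℤ → ℂ) (α β : ℝ) : ℂ := ∑' k, a k * dker m k α β

section
variable {b : ℤ → ℂ} (h0 : b 0 = 0) (hb : Summable fun k => ‖b k‖)
include h0

theorem norm_prim_mul_dker_one_le (k : ℤ) (α β : ℝ) :
    ‖prim b k * dker (fun _ _ => 1) k α β‖ ≤ ‖b k‖ := by
  rw [norm_mul]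
  have h1 := norm_dker_le (m := fun _ _ => 1) (k := k) (C := 1) (fun n _ => by simp) α β
  have h2 : ‖b k‖ = |(k:ℝ)| * ‖prim b k‖ := by
    rw [← I_mul_prim h0 k, norm_mul, norm_mul, norm_I, one_mul, Complex.norm_intCast]
  rw [h2, mul_comm |(k:ℝ)|]
  gcongr
  simpa using h1

theorem norm_prim_mul_dker_deriv_le (k : ℤ) (α β : ℝ) :
    ‖prim b k * dker (fun _ l => I * l * 1) k α β‖ ≤ ‖I * k * b k‖ := by
  rw [norm_mul]
  have h1 := norm_dker_deriv_le k α β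
  have h2 : ‖b k‖ = |(k:ℝ)| * ‖prim b k‖ := by
    rw [← I_mul_prim h0 k, norm_mul, norm_mul, norm_I, one_mul, Complex.norm_intCast]
  rw [norm_mul, norm_mul, norm_I, one_mul, Complex.norm_intCast, h2]
  calc _ ≤ ‖prim b k‖ * (|(k:ℝ)| * |(k:ℝ)|) := by gcongr
    _ = _ := by ring

include hb

theorem tendstoUniformly_qker_one : TendstoUniformly
    (fun (S : Finset ℤ) (p : ℝ × ℝ) => qker S (prim b) (fun _ _ => 1) p.1 p.2)
    (fun p => qlim (prim b) (fun _ _ => 1) p.1 p.2) atTop :=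
  tendstoUniformly_tsum hb fun k p => norm_prim_mul_dker_one_le h0 k p.1 p.2

theorem qlim_one_mul (α β : ℝ) : qlim (prim b) (fun _ _ => 1) α β * (ek 1 α - ek 1 β) =
    wser (prim b) α - wser (prim b) β := by
  have ha : Summable fun k => ‖prim b k‖ :=
    Summable.of_nonneg_of_le (fun _ => norm_nonneg _) (norm_prim_le h0) hb
  have h1 : Summable fun k => prim b k * dker (fun _ _ => 1) k α β :=
    Summable.of_norm_bounded hb fun k => norm_prim_mul_dker_one_le h0 k α β
  rw [qlim, ← tsum_mul_right, ← ((hasSum_wser ha α).sub (hasSum_wser ha β)).tsum_eq]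
  refine tsum_congr fun k => ?_
  rw [mul_assoc, dker_one_mul]; ring

theorem norm_qlim_one_ge (h : ∀ α β, 1 / 8 * ‖ek 1 α - ek 1 β‖ ≤
    ‖wser (prim b) α - wser (prim b) β‖) (α β : ℝ) :
    1 / 8 ≤ ‖qlim (prim b) (fun _ _ => 1) α β‖ := by
  have hc : Continuous fun α => qlim (prim b) (fun _ _ => 1) α β :=
    ((tendstoUniformly_qker_one h0 hb).comp (fun α : ℝ => (α, β))).continuous
      (Eventually.of_forall fun S => continuous_qker_left S _ _ β).frequently
  have hcl : IsClosed {α | 1 / 8 ≤ ‖qlim (prim b) (fun _ _ => 1) α β‖} :=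
    isClosed_le continuous_const hc.norm
  have hd : Dense {α | 1 / 8 ≤ ‖qlim (prim b) (fun _ _ => 1) α β‖} := by
    refine ((countable_ek_one_eq β).dense_compl ℝ).mono fun α hα => ?_
    have h1 : 0 < ‖ek 1 α - ek 1 β‖ := norm_pos_iff.2 (sub_ne_zero.2 hα)
    have h2 := h α β
    rw [← qlim_one_mul h0 hb, norm_mul] at h2
    exact le_of_mul_le_mul_right h2 h1
  have := hcl.closure_eq ▸ hd α
  exact this

theorem eventually_norm_qker_ge (h : ∀ α β, 1 / 8 * ‖ek 1 α - ek 1 β‖ ≤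
    ‖wser (prim b) α - wser (prim b) β‖) :
    ∀ᶠ S in atTop, ∀ α β, 1 / 16 ≤ ‖qker S (prim b) (fun _ _ => 1) α β‖ := by
  filter_upwards [Metric.tendstoUniformly_iff.1 (tendstoUniformly_qker_one h0 hb) (1/16)
    (by norm_num)] with S hS α β
  have h1 := hS (α, β)
  have h2 := norm_qlim_one_ge h0 hb h α β
  rw [dist_eq_norm] at h1
  have h3 := norm_sub_norm_le (qlim (prim b) (fun _ _ => 1) α β)
    (qker S (prim b) (fun _ _ => 1) α β)
  simp only at h1
  linarith

theorem qlim_deriv_mul (α β : ℝ) : qlim (prim b) (fun _ l => I * l * 1) α β * (ek 1 α - ek 1 β) =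
    I * ek 1 β * qlim (prim b) (fun _ _ => 1) α β - wser b β := by
  have h1 : Summable fun k => prim b k * dker (fun _ _ => 1) k α β :=
    Summable.of_norm_bounded hb fun k => norm_prim_mul_dker_one_le h0 k α β
  rw [qlim, qlim, ← tsum_mul_right, ← tsum_mul_left,
    ← ((h1.mul_left (I * ek 1 β)).hasSum.sub (hasSum_wser hb β)).tsum_eq]
  refine tsum_congr fun k => ?_
  rw [mul_assoc, dker_deriv_mul, ← I_mul_prim h0 k]; ring

end

theorem half_cot_eq {α β : ℝ} (h : ek 1 α ≠ ek 1 β) :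
    1 / 2 * (rcot ((α - β) / 2) : ℂ) = I * ek 1 β / (ek 1 α - ek 1 β) + I / 2 := by
  set x : ℂ := (((α - β) / 2 : ℝ) : ℂ) with hx
  have e1 : ek 1 α = ek 1 β * (exp (x * I) * exp (x * I)) := by
    rw [← exp_I_eq_ek_one, ← exp_I_eq_ek_one, ← Complex.exp_add, ← Complex.exp_add, hx]
    congr 1; push_cast; ring
  have hb : ek 1 β ≠ 0 := by rw [← norm_pos_iff, norm_ek]; norm_num
  have hE : exp (x * I) ≠ 0 := Complex.exp_ne_zero _
  have hd : exp (x * I) * exp (x * I) - 1 ≠ 0 := fun h0 => h (by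
    rw [e1, sub_eq_zero.1 h0, mul_one])
  have hr : (rcot ((α - β) / 2) : ℂ) = Complex.cos x / Complex.sin x := by
    rw [rcot, ofReal_div, ofReal_cos, ofReal_sin]
  rw [hr, Complex.cos, Complex.sin, e1, ← mul_sub_one, mul_comm I, mul_div_mul_left _ _ hb, neg_mul,
    Complex.exp_neg]
  generalize exp (x * I) = E at *
  have hs : E⁻¹ - E ≠ 0 := by
    contrapose! hd
    field_simp at hd
    linear_combination -hd
  have hs' : 1 - E ^ 2 ≠ 0 := by contrapose! hd; linear_combination -hd
  have hd' : E ^ 2 - 1 ≠ 0 := by contrapose! hd; linear_combination hd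
  rw [← pow_two] at hd ⊢
  field_simp
  simp only [I_sq]
  ring

/-- The kernel of the operator `𝒦`. -/
def hlim (b : ℤ → ℂ) (α β : ℝ) : ℂ :=
  -(I / 2) - (qlim (prim b) (fun _ _ => 1) α β)⁻¹ * qlim (prim b) (fun _ l => I * l * 1) α β

theorem hlim_periodic_left (b : ℤ → ℂ) (β : ℝ) :
    Function.Periodic (fun α => hlim b α β) (2*π) := fun α => by
  simp only [hlim, qlim, dker, ek_periodic _ α]

theorem hlim_periodic_right (b : ℤ → ℂ) (α : ℝ) :
    Function.Periodic (fun β => hlim b α β) (2*π) := fun β => by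
  simp only [hlim, qlim, dker, ek_periodic _ β]

theorem continuous_dker (m : ℤ → ℤ → ℂ) (k : ℤ) :
    Continuous fun p : ℝ × ℝ => dker m k p.1 p.2 := by
  unfold dker
  have := continuous_ek
  fun_prop

section
variable {b : ℤ → ℂ} (h0 : b 0 = 0) (hb : Summable fun k => ‖b k‖)
  (hb' : Summable fun k : ℤ => ‖I * k * b k‖)
  (h : ∀ α β, 1 / 8 * ‖ek 1 α - ek 1 β‖ ≤ ‖wser (prim b) α - wser (prim b) β‖)
include h0 hb h

theorem qlim_one_ne_zero (α β : ℝ) : qlim (prim b) (fun _ _ => 1) α β ≠ 0 :=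
  norm_pos_iff.1 (lt_of_lt_of_le (by norm_num) (norm_qlim_one_ge h0 hb h α β))

theorem hlim_eq {α β : ℝ} (hne : ek 1 α ≠ ek 1 β) : hlim b α β =
    wser b β / (wser (prim b) α - wser (prim b) β) - 1 / 2 * (rcot ((α - β) / 2) : ℂ) := by
  have hq := qlim_one_ne_zero h0 hb h α β
  have hd : ek 1 α - ek 1 β ≠ 0 := sub_ne_zero.2 hne
  have e2 := qlim_deriv_mul h0 hb α β
  rw [half_cot_eq hne, ← qlim_one_mul h0 hb, hlim]
  generalize qlim (prim b) (fun _ l => I * l * 1) α β = q' at *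
  field_simp
  linear_combination (-2) * e2

include hb'

theorem continuous_hlim : Continuous fun p : ℝ × ℝ => hlim b p.1 p.2 := by
  refine continuous_const.sub (Continuous.mul (Continuous.inv₀ ?_ fun p =>
    qlim_one_ne_zero h0 hb h p.1 p.2) ?_)
  · exact continuous_tsum (fun k => continuous_const.mul (continuous_dker _ k)) hb
      fun k p => norm_prim_mul_dker_one_le h0 k p.1 p.2
  · exact continuous_tsum (fun k => continuous_const.mul (continuous_dker _ k)) hb'
      fun k p => norm_prim_mul_dker_deriv_le h0 k p.1 p.2

theorem tendsto_hker (α β : ℝ) :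
    Tendsto (fun S => hker S (prim b) α β) atTop (nhds (hlim b α β)) := by
  refine tendsto_const_nhds.sub (Tendsto.mul (Tendsto.inv₀ ?_ (qlim_one_ne_zero h0 hb h α β)) ?_)
  · exact (Summable.of_norm_bounded hb fun k => norm_prim_mul_dker_one_le h0 k α β).hasSum
  · exact (Summable.of_norm_bounded hb' fun k => norm_prim_mul_dker_deriv_le h0 k α β).hasSum

omit hb h

theorem norm_hker_le {S : Finset ℤ} {α β : ℝ}
    (hQ : 1 / 16 ≤ ‖qker S (prim b) (fun _ _ => 1) α β‖) :
    ‖hker S (prim b) α β‖ ≤ 1 / 2 + 16 * ∑' k : ℤ, ‖I * k * b k‖ := by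
  refine (norm_sub_le _ _).trans (add_le_add (by simp) ?_)
  rw [norm_mul, norm_inv]
  refine mul_le_mul (inv_le_of_inv_le₀ (by norm_num) (by linarith)) ?_ (norm_nonneg _)
    (by norm_num)
  refine (norm_sum_le_of_le _ fun k _ => norm_prim_mul_dker_deriv_le h0 k α β).trans ?_
  exact hb'.sum_le_tsum _ fun _ _ => norm_nonneg _

end

theorem tendsto_fc {A : ℕ → ℝ → ℂ} {A' : ℝ → ℂ} {M : ℝ} (hA : ∀ᶠ N in atTop, Continuous (A N))
    (hM : ∀ᶠ N in atTop, ∀ x, ‖A N x‖ ≤ M) (h : ∀ x, Tendsto (fun N => A N x) atTop (nhds (A' x)))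
    (n : ℤ) : Tendsto (fun N => fc (A N) n) atTop (nhds (fc A' n)) := by
  simp only [fc_eq]
  refine Tendsto.const_mul _ (intervalIntegral.tendsto_integral_filter_of_dominated_convergence
    (fun _ => M) ?_ ?_ (by simp) ?_)
  · filter_upwards [hA] with N hN using ((continuous_ek _).mul hN).aestronglyMeasurable
  · filter_upwards [hM] with N hN using Eventually.of_forall fun x _ => by
      rw [norm_mul, norm_ek, one_mul]; exact hN x
  · exact Eventually.of_forall fun x _ => (h x).const_mul _

theorem tendsto_integral_mul {F G : ℕ → ℝ → ℂ} {F' G' : ℝ → ℂ} {Φ : ℝ → ℝ} {M : ℝ}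
    (hF : ∀ N, IntervalIntegrable (F N) volume 0 (2*π)) (hΦ : ∀ N x, ‖F N x‖ ≤ Φ x)
    (iΦ : IntervalIntegrable Φ volume 0 (2*π))
    (hl : ∀ᵐ x, x ∈ Set.Ioc 0 (2*π) → Tendsto (fun N => F N x) atTop (nhds (F' x)))
    (hG : ∀ᶠ N in atTop, Continuous (G N)) (hM : ∀ᶠ N in atTop, ∀ x, ‖G N x‖ ≤ M)
    (hG' : ∀ x, Tendsto (fun N => G N x) atTop (nhds (G' x))) :
    Tendsto (fun N => ∫ β in (0:ℝ)..(2*π), F N β * G N β) atTop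
      (nhds (∫ β in (0:ℝ)..(2*π), F' β * G' β)) := by
  refine intervalIntegral.tendsto_integral_filter_of_dominated_convergence
    (fun x => Φ x * M) ?_ ?_ (iΦ.mul_const _) ?_
  · filter_upwards [hG] with N hN
    rw [Set.uIoc_of_le Real.two_pi_pos.le]
    exact (hF N).1.aestronglyMeasurable.mul hN.aestronglyMeasurable
  · filter_upwards [hM] with N hN using Eventually.of_forall fun x _ => by
      rw [norm_mul]
      exact mul_le_mul (hΦ N x) (hN x) (norm_nonneg _) ((norm_nonneg _).trans (hΦ N x))
  · filter_upwards [hl] with x hx hx'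
    rw [Set.uIoc_of_le Real.two_pi_pos.le] at hx'
    exact (hx hx').mul (hG' x)

section
variable {b : ℤ → ℂ} (h0 : b 0 = 0) (hb : Summable fun k => ‖b k‖)
  (hb' : Summable fun k : ℤ => ‖I * k * b k‖)
  (h : ∀ α β, 1 / 8 * ‖ek 1 α - ek 1 β‖ ≤ ‖wser (prim b) α - wser (prim b) β‖)
include h0 hb hb' h

theorem norm_hlim_le (α β : ℝ) : ‖hlim b α β‖ ≤ 1 / 2 + 16 * ∑' k : ℤ, ‖I * k * b k‖ := by
  refine le_of_tendsto (tendsto_hker h0 hb hb' h α β).norm ?_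
  filter_upwards [eventually_norm_qker_ge h0 hb h] with S hS using norm_hker_le h0 hb' (hS α β)

theorem tendsto_integral_mul_fc_hker {S : ℕ → Finset ℤ} (hS : Tendsto S atTop atTop)
    {F : ℕ → ℝ → ℂ} {F' : ℝ → ℂ} {Φ : ℝ → ℝ}
    (hF : ∀ N, IntervalIntegrable (F N) volume 0 (2*π)) (hΦ : ∀ N x, ‖F N x‖ ≤ Φ x)
    (iΦ : IntervalIntegrable Φ volume 0 (2*π))
    (hl : ∀ᵐ x, x ∈ Set.Ioc 0 (2*π) → Tendsto (fun N => F N x) atTop (nhds (F' x))) (n : ℤ) :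
    Tendsto (fun N : ℕ => ∫ β in (0:ℝ)..(2*π),
        F N β * fc (fun α => hker (S N) (prim b) α β) n) atTop
      (nhds (∫ β in (0:ℝ)..(2*π), F' β * fc (fun α => hlim b α β) n)) := by
  have hQ := hS.eventually (eventually_norm_qker_ge h0 hb h)
  have hQ0 : ∀ᶠ N : ℕ in atTop, Continuous fun p : ℝ × ℝ =>
      hker (S N) (prim b) p.1 p.2 := hQ.mono fun N hN =>
    continuous_hker fun α β => norm_pos_iff.1 (lt_of_lt_of_le (by norm_num) (hN α β))
  have hQ1 (x : ℝ) : ∀ᶠ N : ℕ in atTop, Continuous fun α => hker (S N) (prim b) α x := by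
    filter_upwards [hQ0] with N hN
    have e : Continuous fun α : ℝ => (α, x) := by fun_prop
    have e' := hN.comp e
    simp only [Function.comp_def] at e'
    exact e'
  have hM (x : ℝ) : ∀ᶠ N : ℕ in atTop, ∀ α, ‖hker (S N) (prim b) α x‖ ≤
      1 / 2 + 16 * ∑' k : ℤ, ‖I * k * b k‖ := by
    filter_upwards [hQ] with N hN α
    exact norm_hker_le h0 hb' (hN α x)
  have hG : ∀ᶠ N in atTop, Continuous fun β => fc (fun α => hker (S N) (prim b) α β) n :=
    hQ0.mono fun N hN => continuous_fc_param hN n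
  have hG1 : ∀ᶠ N in atTop, ∀ β, ‖fc (fun α => hker (S N) (prim b) α β) n‖ ≤
      1 / 2 + 16 * ∑' k : ℤ, ‖I * k * b k‖ :=
    hQ.mono fun N hN x => norm_fc_le (fun α => norm_hker_le h0 hb' (hN α x)) n
  have hG2 : ∀ β, Tendsto (fun N => fc (fun α => hker (S N) (prim b) α β) n) atTop
      (nhds (fc (fun α => hlim b α β) n)) :=
    fun x => tendsto_fc (hQ1 x) (hM x) (fun α => (tendsto_hker h0 hb hb' h α x).comp hS) n
  exact tendsto_integral_mul hF hΦ iΦ hl hG hG1 hG2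

omit hb' in
theorem Kop_eq {ω f : ℝ → ℂ} (hω : ∀ x, HasDerivAt ω (wser b x) x)
    (hsub : ∀ α β, ω α - ω β = wser (prim b) α - wser (prim b) β) (hg : ∀ x, ‖wser b x‖ = 1)
    (pf : Function.Periodic f (2*π)) (α : ℝ) : Kop ω f α = (1 / (2 * (π:ℂ) * I)) *
      ∫ β in (0:ℝ)..(2*π), f β * (starRingEnd ℂ) (wser b β) * hlim b α β := by
  have hp : Function.Periodic (fun β => f β * (starRingEnd ℂ) (wser b β) * hlim b α β) (2*π) :=
    fun β => by
      have e := hlim_periodic_right b α β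
      simp only at e ⊢
      rw [pf β, wser_periodic b β, e]
  have e := hp.intervalIntegral_add_eq (α - π) 0
  rw [Kop, zero_add] at *
  rw [← e, show α - π + 2*π = α + π by ring]
  congr 1
  refine intervalIntegral.integral_congr_ae ?_
  filter_upwards [ae_ek_one_ne α] with β hβ _
  have hne : wser b β ≠ 0 := norm_pos_iff.1 (by rw [hg]; norm_num)
  have hc : (starRingEnd ℂ) (wser b β) = (wser b β)⁻¹ := by
    rw [Complex.inv_def, Complex.normSq_eq_norm_sq, hg]; simp
  rw [hlim_eq h0 hb h hβ, (hω β).deriv, hsub, hc]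
  have hd : wser (prim b) α - wser (prim b) β ≠ 0 := by
    have h1 := h α β
    have h2 : 0 < ‖ek 1 α - ek 1 β‖ := norm_pos_iff.2 (sub_ne_zero.2 hβ)
    exact norm_pos_iff.1 (by linarith)
  generalize wser (prim b) α - wser (prim b) β = d at *
  field_simp

theorem integrable_mul_hlim {F : ℝ → ℂ} (hF : IntervalIntegrable F volume 0 (2*π)) :
    Integrable (fun p : ℝ × ℝ => F p.1 * hlim b p.2 p.1)
      ((volume.restrict (Set.Ioc 0 (2*π))).prod (volume.restrict (Set.Ioc 0 (2*π)))) := by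
  have h1 : Integrable (fun p : ℝ × ℝ => F p.1)
      ((volume.restrict (Set.Ioc 0 (2*π))).prod (volume.restrict (Set.Ioc 0 (2*π)))) :=
    hF.1.comp_fst _
  exact h1.mul_bdd ((continuous_hlim h0 hb hb' h).comp continuous_swap).aestronglyMeasurable
    (Eventually.of_forall fun p => norm_hlim_le h0 hb hb' h p.2 p.1)

end

theorem fc_sum_mul_ek (S : Finset ℤ) (a : ℤ → ℂ) (n : ℤ) :
    fc (fun x => ∑ k ∈ S, a k * ek k x) n = if n ∈ S then a n else 0 := by
  rw [fc_sum S fun k _ => ((continuous_ek k).const_mul (a k)).intervalIntegrable _ _]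
  simp only [fc_const_mul, fc_ek, mul_ite, mul_one, mul_zero, Finset.sum_ite_eq]

theorem lintegral_sum_mul_ek_sq_le (S : Finset ℤ) (a : ℤ → ℂ) :
    (∫⁻ x in Set.Ioc 0 (2*π), ‖∑ k ∈ S, a k * ek k x‖ₑ) ^ 2 ≤
      ENNReal.ofReal (2*π) ^ 2 * energy 0 (fun n => ‖a n‖ₑ) := by
  refine (lintegral_sq_le_energy (Continuous.intervalIntegrable
    (continuous_finsetSum S fun k _ => (continuous_ek k).const_mul (a k)) _ _)).trans ?_
  gcongr
  refine energy_mono fun n => ?_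
  rw [fc_sum_mul_ek]
  split_ifs <;> simp

theorem hasDerivAt_sum_mul_ek (S : Finset ℤ) (a : ℤ → ℂ) (x : ℝ) :
    HasDerivAt (fun x => ∑ k ∈ S, a k * ek k x) (∑ k ∈ S, (I * k * a k) * ek k x) x :=
  HasDerivAt.fun_sum fun k _ => ((hasDerivAt_ek k x).const_mul (a k)).congr_deriv (by ring)

theorem energy_fc_conj (ρ : ℝ) (f : ℝ → ℂ) :
    energy ρ (fun n => ‖fc (fun α => (starRingEnd ℂ) (f α)) n‖ₑ) =
      energy ρ (fun n => ‖fc f n‖ₑ) := by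
  simp only [fc_conj, energy]
  rw [← (Equiv.neg ℤ).tsum_eq]
  refine tsum_congr fun n => ?_
  rw [Equiv.neg_apply, neg_neg, ← ofReal_norm, RCLike.norm_conj, ofReal_norm, wt, wt, Int.natAbs_neg]

theorem enorm_const_mul_two_pi : ‖1 / (2 * (π:ℂ) * I)‖ₑ * ENNReal.ofReal (2*π) = 1 := by
  rw [← ofReal_norm, ← ENNReal.ofReal_mul (norm_nonneg _)]
  simp [abs_of_pos Real.pi_pos]
  field_simp

section
variable {b : ℤ → ℂ} (h0 : b 0 = 0) (hb : Summable fun k => ‖b k‖)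
  (hb' : Summable fun k : ℤ => ‖I * k * b k‖)
  (h : ∀ α β, 1 / 8 * ‖ek 1 α - ek 1 β‖ ≤ ‖wser (prim b) α - wser (prim b) β‖)
  {ω : ℝ → ℂ} (hω : ∀ x, HasDerivAt ω (wser b x) x)
  (hsub : ∀ α β, ω α - ω β = wser (prim b) α - wser (prim b) β) (hg : ∀ x, ‖wser b x‖ = 1)
  {f : ℝ → ℂ} (pf : Function.Periodic f (2*π)) (hf : IntervalIntegrable f volume 0 (2*π))
include h0 hb h hω hsub hg pf

theorem Kop_periodic : Function.Periodic (Kop ω f) (2*π) := fun α => by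
  have e := fun β => hlim_periodic_left b β α
  simp only at e
  simp only [Kop_eq h0 hb h hω hsub hg pf, e]

include hb' hf

theorem intervalIntegrable_Kop : IntervalIntegrable (Kop ω f) volume 0 (2*π) := by
  have hF := hf.mul_continuousOn (Complex.continuous_conj.comp (continuous_wser hb)).continuousOn
  have := (integrable_mul_hlim h0 hb hb' h hF).integral_prod_right
  rw [intervalIntegrable_iff_integrableOn_Ioc_of_le Real.two_pi_pos.le, funext
    (Kop_eq h0 hb h hω hsub hg pf)]
  simp only [intervalIntegral.integral_of_le Real.two_pi_pos.le]
  exact this.const_mul _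

theorem fc_Kop (n : ℤ) : fc (Kop ω f) n = (1 / (2 * (π:ℂ) * I)) *
    ∫ β in (0:ℝ)..(2*π), f β * (starRingEnd ℂ) (wser b β) * fc (fun α => hlim b α β) n := by
  have hF := hf.mul_continuousOn (Complex.continuous_conj.comp (continuous_wser hb)).continuousOn
  rw [funext (Kop_eq h0 hb h hω hsub hg pf), fc_const_mul]
  congr 1
  exact (integral_mul_fc_eq (integrable_mul_hlim h0 hb hb' h hF) n).symm

end

theorem energy_Kop_le_of_tendsto {b : ℤ → ℂ} (h0 : b 0 = 0) (hb : Summable fun k => ‖b k‖)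
    (hb' : Summable fun k : ℤ => ‖I * k * b k‖)
    (h : ∀ α β, 1 / 8 * ‖ek 1 α - ek 1 β‖ ≤ ‖wser (prim b) α - wser (prim b) β‖)
    {ω : ℝ → ℂ} (hω : ∀ x, HasDerivAt ω (wser b x) x)
    (hsub : ∀ α β, ω α - ω β = wser (prim b) α - wser (prim b) β) (hg : ∀ x, ‖wser b x‖ = 1)
    {f : ℝ → ℂ} (pf : Function.Periodic f (2*π)) (hf : IntervalIntegrable f volume 0 (2*π))
    {S : ℕ → Finset ℤ} (hS : Tendsto S atTop atTop)
    {F : ℕ → ℝ → ℂ} {Φ : ℝ → ℝ}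
    (hF : ∀ N, IntervalIntegrable (F N) volume 0 (2*π)) (hΦ : ∀ N x, ‖F N x‖ ≤ Φ x)
    (iΦ : IntervalIntegrable Φ volume 0 (2*π))
    (hl : ∀ᵐ x, x ∈ Set.Ioc 0 (2*π) →
      Tendsto (fun N => F N x) atTop (nhds (f x * (starRingEnd ℂ) (wser b x))))
    {ρ : ℝ} {B : ℝ≥0∞} (hB : ∀ S : Finset ℤ,
      (∀ α β, 1 / 16 ≤ ‖qker S (prim b) (fun _ _ => 1) α β‖) → ∀ N,
      energy ρ (fun n => ‖∫ β in (0:ℝ)..(2*π), F N β * fc (fun α => hker S (prim b) α β) n‖ₑ) ≤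
        ENNReal.ofReal (2*π) ^ 2 * B) :
    energy ρ (fun n => ‖fc (Kop ω f) n‖ₑ) ≤ B := by
  have h1 := energy_le_of_tendsto (ρ := ρ) (B := ENNReal.ofReal (2*π) ^ 2 * B)
    (fun n => tendsto_integral_mul_fc_hker h0 hb hb' h hS hF hΦ iΦ hl n) (by
      filter_upwards [hS.eventually (eventually_norm_qker_ge h0 hb h)] with N hN using hB _ hN N)
  simp only [fc_Kop h0 hb hb' h hω hsub hg pf hf, enorm_mul]
  rw [energy_const_mul]
  calc _ ≤ ‖1 / (2 * (π:ℂ) * I)‖ₑ ^ 2 * (ENNReal.ofReal (2*π) ^ 2 * B) := by gcongr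
    _ = B := by rw [← mul_assoc, ← mul_pow, enorm_const_mul_two_pi, one_pow, one_mul]

theorem energy_Kop_le {s : ℝ} (hs : 2 ≤ s) : ∃ (C : ℝ≥0) (p : ℕ),
    ∀ b : ℤ → ℂ, b 0 = 0 → energy s (fun n => ‖b n‖ₑ) ≠ ⊤ →
      (∀ α β, 1 / 8 * ‖ek 1 α - ek 1 β‖ ≤ ‖wser (prim b) α - wser (prim b) β‖) →
      ∀ ω : ℝ → ℂ, (∀ x, HasDerivAt ω (wser b x) x) →
      (∀ α β, ω α - ω β = wser (prim b) α - wser (prim b) β) → (∀ x, ‖wser b x‖ = 1) →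
      ∀ f : ℝ → ℂ, Function.Periodic f (2*π) → IntervalIntegrable f volume 0 (2*π) →
      energy (s - 2) (fun n => ‖fc (Kop ω f) n‖ₑ) ≤ energy 0 (fun n => ‖fc f n‖ₑ) *
        (C * (1 + energy (s - 1) (fun n => ‖b n‖ₑ)) ^ p) ∧
      (energy 1 (fun n => ‖fc f n‖ₑ) ≠ ⊤ →
        energy (s - 1) (fun n => ‖fc (Kop ω f) n‖ₑ) ≤ energy 1 (fun n => ‖fc f n‖ₑ) *
          (C * (1 + energy (s - 1) (fun n => ‖b n‖ₑ)) ^ p)) := by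
  obtain ⟨C, p, hC⟩ := energy_hker_le hs
  obtain ⟨D, hD⟩ := energy_fc_mul 1
  refine ⟨C + 8 * C * D, p + 1, fun b h0 hE h ω hω hsub hg f pf hf => ?_⟩
  have hb : Summable fun k => ‖b k‖ := summable_norm_of_energy (by linarith) hE
  have hb' := summable_norm_mul_of_energy hs hE
  have hE' : energy (s - 1) (fun n => ‖b n‖ₑ) ≠ ⊤ :=
    ne_top_of_le_ne_top hE (energy_mono_exp (by linarith) _)
  set E := energy (s - 1) (fun n => ‖b n‖ₑ) with hEdef
  have cg : Continuous fun x => (starRingEnd ℂ) (wser b x) :=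
    Complex.continuous_conj.comp (continuous_wser hb)
  have hF : IntervalIntegrable (fun x => f x * (starRingEnd ℂ) (wser b x)) volume 0 (2*π) :=
    hf.mul_continuousOn cg.continuousOn
  obtain ⟨S, hS⟩ := exists_seq_tendsto (atTop : Filter (Finset ℤ))
  have hEp : (1 + E) ^ p ≤ (1 + E) ^ (p + 1) := pow_le_pow_right₀ le_self_add (by omega)
  constructor
  · refine energy_Kop_le_of_tendsto h0 hb hb' h hω hsub hg pf hf hS (fun _ => hF)
      (Φ := fun x => ‖f x * (starRingEnd ℂ) (wser b x)‖) (fun _ _ => le_rfl) hF.norm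
      (Eventually.of_forall fun x _ => tendsto_const_nhds) fun S hQ N => ?_
    refine (hC S _ b (enorm_prim_le h0) (fun k => natAbs_mul_enorm_prim_le h0 k) hE' hQ _
      hF).1.trans ?_
    have e : ∀ x, ‖f x * (starRingEnd ℂ) (wser b x)‖ₑ = ‖f x‖ₑ := fun x => by
      rw [← ofReal_norm, norm_mul, RCLike.norm_conj, hg, mul_one, ofReal_norm]
    simp only [e]
    rw [← mul_assoc (ENNReal.ofReal (2*π) ^ 2)]
    refine mul_le_mul' (lintegral_sq_le_energy hf) (mul_le_mul' ?_ hEp)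
    exact_mod_cast le_self_add
  · intro hf1
    set F : ℝ → ℂ := fun x => f x * (starRingEnd ℂ) (wser b x) with hFdef
    have hF1 : energy 1 (fun n => ‖fc F n‖ₑ) ≤ D * (E * energy 1 (fun n => ‖fc f n‖ₑ)) := by
      have e1 : energy 1 (fun n => ‖fc (fun x => (starRingEnd ℂ) (wser b x)) n‖ₑ) ≤ E := by
        rw [energy_fc_conj]
        simp only [fc_wser hb]
        exact energy_mono_exp (by linarith) _
      have e2 := hD 1 1 zero_le_one le_rfl le_rfl le_rfl _ f (cg.intervalIntegrable _ _) hf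
        (ne_top_of_le_ne_top hE' e1)
      simp only [mul_comm _ (f _)] at e2
      exact e2.trans (by gcongr)
    have hF1' : energy 1 (fun n => ‖fc F n‖ₑ) ≠ ⊤ := ne_top_of_le_ne_top
      (ENNReal.mul_ne_top ENNReal.coe_ne_top (ENNReal.mul_ne_top hE' hf1)) hF1
    have hFs := summable_norm_of_energy le_rfl hF1'
    refine energy_Kop_le_of_tendsto h0 hb hb' h hω hsub hg pf hf hS
      (F := fun N x => ∑ k ∈ S N, fc F k * ek k x) (fun N => Continuous.intervalIntegrable
        (continuous_finsetSum _ fun k _ => (continuous_ek k).const_mul _) _ _)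
      (Φ := fun _ => ∑' k, ‖fc F k‖) (fun N x => ?_) (by simp) ?_ fun S hQ N => ?_
    · refine (norm_sum_le_of_le _ fun k _ => (norm_mul_ek _ _ _).le).trans ?_
      exact hFs.sum_le_tsum _ fun _ _ => norm_nonneg _
    · filter_upwards [ae_eq_wser hF hFs] with x hx hx'
      have e := (hasSum_wser hFs x).comp hS
      rw [← hx hx'] at e
      exact e
    · refine ((hC S _ b (enorm_prim_le h0) (fun k => natAbs_mul_enorm_prim_le h0 k) hE' hQ _
        (Continuous.intervalIntegrable
        (continuous_finsetSum _ fun k _ => (continuous_ek k).const_mul _) _ _)).2 _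
        (hasDerivAt_sum_mul_ek _ _)
        (continuous_finsetSum _ fun k _ => (continuous_ek k).const_mul _)
        (fun x => by simp only [ek_periodic _ x])).trans ?_
      have e1 := (lintegral_sum_mul_ek_sq_le (S := ‹ℕ → Finset ℤ› N) (fc F)).trans
        (mul_le_mul_right (energy_mono_exp (zero_le_one (α := ℝ)) _) _)
      have e2 := (lintegral_sum_mul_ek_sq_le (S := ‹ℕ → Finset ℤ› N) (fun k => I * k * fc F k))
      have e3 : energy 0 (fun k : ℤ => ‖I * k * fc F k‖ₑ) ≤ energy 1 (fun n => ‖fc F n‖ₑ) := by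
        simp only [enorm_mul, enorm_I, one_mul, enorm_intCast]
        simpa using energy_natAbs_le 0 (fun n => ‖fc F n‖ₑ)
      calc _ ≤ 4 * (ENNReal.ofReal (2*π) ^ 2 * (D * (E * energy 1 (fun n => ‖fc f n‖ₑ))) +
            ENNReal.ofReal (2*π) ^ 2 * (D * (E * energy 1 (fun n => ‖fc f n‖ₑ)))) *
            (C * (1 + E) ^ p) := by
            gcongr
            · exact e1.trans (by gcongr)
            · exact e2.trans (by gcongr; exact e3.trans hF1)
        _ = ENNReal.ofReal (2*π) ^ 2 * (energy 1 (fun n => ‖fc f n‖ₑ) *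
            ((8 * C * D) * ((1 + E) ^ p * E))) := by ring
        _ ≤ _ := by
            rw [pow_succ (1 + E) p]
            gcongr
            · push_cast; exact le_add_self
            · exact le_add_self

theorem hnormSq_nonneg (s : ℝ) (f : ℝ → ℂ) : 0 ≤ hnormSq s f :=
  add_nonneg (tsum_nonneg fun _ => by positivity) (sq_nonneg _)

theorem hnorm_sq (s : ℝ) (f : ℝ → ℂ) : hnorm s f ^ 2 = hnormSq s f :=
  Real.sq_sqrt (hnormSq_nonneg s f)

theorem one_add_sq_pow_le {y : ℝ} (hy : 0 ≤ y) (p : ℕ) :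
    (1 + y ^ 2) ^ p ≤ Real.exp (p * y) ^ 2 := by
  rw [Real.exp_nat_mul, ← pow_mul, mul_comm p 2, pow_mul]
  refine pow_le_pow_left₀ (by positivity) ?_ p
  have := Real.add_one_le_exp y
  nlinarith

theorem hnorm_le_of_energy_le {ρ σ τ : ℝ} (hρ : 0 ≤ ρ) (hσ : 0 ≤ σ) (hσ' : σ ≤ 1) (hτ : 0 ≤ τ)
    {u f g : ℝ → ℂ} {C : ℝ≥0} {p : ℕ}
    (hf : Summable (fun k : ℤ => |(k:ℝ)| ^ (2*σ) * ‖fc f k‖^2))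
    (hg : energy τ (fun n => ‖fc g n‖ₑ) ≠ ⊤)
    (h : energy ρ (fun n => ‖fc u n‖ₑ) ≤
      energy σ (fun n => ‖fc f n‖ₑ) * (C * (1 + energy τ (fun n => ‖fc g n‖ₑ)) ^ p)) :
    Summable (fun k : ℤ => |(k:ℝ)| ^ (2*ρ) * ‖fc u k‖^2) ∧
      hnorm ρ u ≤ (Real.sqrt (8 * C) + 1) * hnorm σ f *
        Real.exp ((p * 2 ^ τ + 1) * hnorm τ g) := by
  have n0 : ∀ s f, 0 ≤ hnorm s f := fun s f => Real.sqrt_nonneg _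
  have h1 : energy ρ (fun n => ‖fc u n‖ₑ) ≤ ENNReal.ofReal
      (4 * hnorm σ f ^ 2 * (C * (1 + (2 ^ τ * hnorm τ g) ^ 2) ^ p)) := by
    have e1 := energy_le_hnormSq hσ hf
    have e2 := energy_le_hnormSq hτ (summable_and_hnormSq_le hτ hg).1
    have e3 : (4:ℝ) ^ σ ≤ 4 := by
      simpa using Real.rpow_le_rpow_of_exponent_le (by norm_num : (1:ℝ) ≤ 4) hσ'
    have e4 : (4:ℝ) ^ τ = (2 ^ τ) ^ 2 := by
      rw [← Real.rpow_natCast, ← Real.rpow_mul (by norm_num), mul_comm, Real.rpow_mul (by norm_num)]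
      norm_num
    rw [← hnorm_sq] at e1 e2
    rw [e4, ← mul_pow] at e2
    refine h.trans ?_
    rw [ENNReal.ofReal_mul (by positivity), ENNReal.ofReal_mul C.coe_nonneg, ENNReal.ofReal_coe_nnreal,
      ENNReal.ofReal_pow (by positivity), ENNReal.ofReal_add zero_le_one (by positivity),
      ENNReal.ofReal_one]
    gcongr
    exact e1.trans (ENNReal.ofReal_le_ofReal (by gcongr))
  obtain ⟨hs, hle⟩ := summable_and_hnormSq_le hρ (ne_top_of_le_ne_top ENNReal.ofReal_ne_top h1)
  refine ⟨hs, Real.sqrt_le_iff.2 ⟨by have := n0 σ f; positivity, hle.trans ?_⟩⟩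
  have h2 := ENNReal.toReal_mono ENNReal.ofReal_ne_top h1
  rw [ENNReal.toReal_ofReal (by positivity)] at h2
  have hy : 0 ≤ 2 ^ τ * hnorm τ g := mul_nonneg (by positivity) (n0 _ _)
  calc _ ≤ 2 * (4 * hnorm σ f ^ 2 * (C * (1 + (2 ^ τ * hnorm τ g) ^ 2) ^ p)) := by gcongr
    _ ≤ 2 * (4 * hnorm σ f ^ 2 * (C * Real.exp (p * (2 ^ τ * hnorm τ g)) ^ 2)) := by
        gcongr; exact one_add_sq_pow_le hy p
    _ = (Real.sqrt (8 * C) * hnorm σ f * Real.exp (p * (2 ^ τ * hnorm τ g))) ^ 2 := by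
        rw [mul_pow, mul_pow, Real.sq_sqrt (by positivity)]; ring
    _ ≤ _ := by
        have := n0 σ f
        have h3 : p * (2 ^ τ * hnorm τ g) ≤ (p * 2 ^ τ + 1) * hnorm τ g := by
          linarith [n0 τ g]
        gcongr
        linarith

/-- mapping properties of the operator 𝒦[ω] (Lemma 3.7). -/
theorem Kop_mapping (s : ℝ) (hs : 2 ≤ s) :
    ∃ ε₁ : ℝ, 0 < ε₁ ∧ ∃ C₁ : ℝ, 0 < C₁ ∧ ∃ C₂ : ℝ, 0 < C₂ ∧
    ∀ θt : ℝ → ℂ, ∀ c : ℂ, MemHdot s θt → hnorm 1 θt < ε₁ → ConstraintB4 θt c →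
      (∀ α β : ℝ, 0 < |α - β| → |α - β| ≤ π →
        (1/8 : ℝ) ≤ ‖q1 (omegaCurve θt c) α β‖) →
      (∀ f : ℝ → ℂ, MemH 0 f →
        MemH (s-2) (Kop (omegaCurve θt c) f) ∧
        hnorm (s-2) (Kop (omegaCurve θt c) f)
          ≤ C₁ * hnorm 0 f * Real.exp (C₂ * hnorm (s-1) (deriv (omegaCurve θt c)))) ∧
      (∀ f : ℝ → ℂ, MemH 1 f →
        MemH (s-1) (Kop (omegaCurve θt c) f) ∧
        hnorm (s-1) (Kop (omegaCurve θt c) f)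
          ≤ C₁ * hnorm 1 f * Real.exp (C₂ * hnorm (s-1) (deriv (omegaCurve θt c)))) := by
  obtain ⟨C, p, hC⟩ := energy_Kop_le hs
  refine ⟨1, one_pos, Real.sqrt (8 * C) + 1, by positivity, p * 2 ^ (s - 1) + 1, by positivity,
    fun θt c hθ _ hB4 hq => ?_⟩
  obtain ⟨g, cg, pg, ng, hE, hae⟩ := exists_tangent hs c hθ
  have hω : ∀ x, HasDerivAt (omegaCurve θt c) (g x) x := hasDerivAt_omegaCurve cg hae
  have h0 := fc_zero_of_constraint hB4 hae
  have hb : Summable fun k => ‖fc g k‖ := summable_norm_of_energy (by linarith) hE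
  have hb' := summable_norm_mul_of_energy hs hE
  have hE' : energy (s - 1) (fun n => ‖fc g n‖ₑ) ≠ ⊤ :=
    ne_top_of_le_ne_top hE (energy_mono_exp (by linarith) _)
  have hsub := sub_eq_wser_prim hω cg pg h0 hb
  have h := arc_chord hω cg (periodic_of_sub_eq_wser hsub) hq
  simp only [hsub] at h
  have hgw : g = wser (fc g) := eq_wser cg pg hb
  have hω' : ∀ x, HasDerivAt (omegaCurve θt c) (wser (fc g) x) x := by rwa [← hgw]
  have ng' : ∀ x, ‖wser (fc g) x‖ = 1 := by rwa [← hgw]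
  have hd : deriv (omegaCurve θt c) = g := funext fun x => (hω x).deriv
  rw [hd]
  constructor
  · rintro f ⟨pf, hf, sf⟩
    have e := hnorm_le_of_energy_le (by linarith) le_rfl zero_le_one (by linarith) sf hE'
      (hC _ h0 hE h _ hω' hsub ng' f pf hf).1
    exact ⟨⟨Kop_periodic h0 hb h hω' hsub ng' pf,
      intervalIntegrable_Kop h0 hb hb' h hω' hsub ng' pf hf, e.1⟩, e.2⟩
  · rintro f ⟨pf, hf, sf⟩
    have e := hnorm_le_of_energy_le (by linarith) zero_le_one le_rfl (by linarith) sf hE'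
      ((hC _ h0 hE h _ hω' hsub ng' f pf hf).2
        (ne_top_of_le_ne_top ENNReal.ofReal_ne_top (energy_le_hnormSq zero_le_one sf)))
    exact ⟨⟨Kop_periodic h0 hb h hω' hsub ng' pf,
      intervalIntegrable_Kop h0 hb hb' h hω' hsub ng' pf hf, e.1⟩, e.2⟩

end HeleShaw
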